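/- Let K/k be a finitely generated field extension and A a central simple algebra of degree n with center K. Then A is isomorphic as a k-algebra to k_n(X) for some irreducible n-variety X. Moreover, X is uniquely determined by A up to birational isomorphism of n-varieties. -/

import Mathlib

set_option linter.unusedSectionVars false

noncomputable section

universe u

-- Throughout, `k` is an algebraically closed base field of characteristic zero.
variable (k : Type) [Field k] [IsAlgClosed k] [CharZero k]

/-- Index type for the `m·n²` commuting variables `x_{ij}^{(h)}`. -/
abbrev MIdx (n m : ℕ) := Fin m × Fin n × Fin n

/-- The commutative polynomial ring `k[x_{ij}^{(h)}]`. -/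
abbrev PolyRing (n m : ℕ) := MvPolynomial (MIdx n m) k

/-- Matrices over the polynomial ring `k[x_{ij}^{(h)}]`. -/
abbrev MatPoly (n m : ℕ) := Matrix (Fin n) (Fin n) (PolyRing k n m)

/-- The space `(M_n)^m` of `m`-tuples of `n×n` matrices over `k`. -/
abbrev MTuple (n m : ℕ) := Fin m → Matrix (Fin n) (Fin n) k

/-- The `h`-th generic `n×n` matrix `X_h = (x_{ij}^{(h)})`. -/
def genericMatrix (n m : ℕ) (h : Fin m) : MatPoly k n m :=
  Matrix.of fun i j => MvPolynomial.X (h, i, j)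

/-- `G_{m,n}`, the algebra of `m` generic `n×n` matrices: the `k`-subalgebra of
`M_n(k[x_{ij}^{(h)}])` generated by the generic matrices. -/
def GMN (n m : ℕ) : Subalgebra k (MatPoly k n m) :=
  Algebra.adjoin k (Set.range (genericMatrix k n m))

/-- Evaluation of the commuting variables at a point `a ∈ (M_n)^m`. -/
def polyEval {n m : ℕ} (a : MTuple k n m) : PolyRing k n m →ₐ[k] k :=
  MvPolynomial.aeval fun x : MIdx n m => a x.1 x.2.1 x.2.2

/-- Evaluation of matrix-valued polynomials at a point `a ∈ (M_n)^m`; under this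
map an element of `G_{m,n}` (or `T_{m,n}`) becomes a `PGL_n`-equivariant polynomial
map `(M_n)^m → M_n`. -/
def evalMat {n m : ℕ} (a : MTuple k n m) :
    MatPoly k n m →ₐ[k] Matrix (Fin n) (Fin n) k :=
  (polyEval k a).mapMatrix

/-- The scalar matrix `tr(p)·1 ∈ M_n(k[x_{ij}^{(h)}])`. -/
def traceScalar {n m : ℕ} (p : MatPoly k n m) : MatPoly k n m :=
  algebraMap (PolyRing k n m) (MatPoly k n m) (Matrix.trace p)

/-- `T_{m,n}`, the trace ring of `G_{m,n}`: the `k`-algebra generated inside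
`M_n(k[x_{ij}^{(h)}])` by `G_{m,n}` together with the traces of its elements. -/
def TMN (n m : ℕ) : Subalgebra k (MatPoly k n m) :=
  Algebra.adjoin k ((GMN k n m : Set (MatPoly k n m)) ∪
    (traceScalar k '' (GMN k n m : Set (MatPoly k n m))))

lemma GMN_le_TMN (n m : ℕ) : GMN k n m ≤ TMN k n m :=
  fun _ hx => Algebra.subset_adjoin (Or.inl hx)

/-- The inclusion `G_{m,n} → T_{m,n}`. -/
def inclGT (n m : ℕ) : ↥(GMN k n m) →+* ↥(TMN k n m) :=
  (Subalgebra.inclusion (GMN_le_TMN k n m) : ↥(GMN k n m) →ₐ[k] ↥(TMN k n m)).toRingHom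

/-- `U_{m,n}`: the set of `m`-tuples of `n×n` matrices generating `M_n` as a
`k`-algebra. -/
def genTuples (n m : ℕ) : Set (MTuple k n m) :=
  {a | Algebra.adjoin k (Set.range a) = ⊤}

/-- Simultaneous conjugation of an `m`-tuple by `g ∈ GL_n(k)`; since scalar
matrices act trivially, this is the `PGL_n`-action on `(M_n)^m`. -/
def conjAct {n m : ℕ} (g : GL (Fin n) k) (a : MTuple k n m) : MTuple k n m :=
  fun i =>
    (g : Matrix (Fin n) (Fin n) k) * a i * ((g⁻¹ : GL (Fin n) k) : Matrix (Fin n) (Fin n) k)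

/-- Zariski closed subsets of `(M_n)^m`. -/
def IsZClosed {n m : ℕ} (C : Set (MTuple k n m)) : Prop :=
  ∃ S : Set (PolyRing k n m), C = {a | ∀ p ∈ S, polyEval k a p = 0}

/-- `X` is an `n`-variety: a closed `PGL_n`-invariant subvariety of `U_{m,n}`,
i.e. `X = X̄ ∩ U_{m,n}` where `X̄` is the Zariski closure of `X` in `(M_n)^m`. -/
def IsNVariety {n m : ℕ} (X : Set (MTuple k n m)) : Prop :=
  X ⊆ genTuples k n m ∧
  (∀ g : GL (Fin n) k, ∀ a ∈ X, conjAct k g a ∈ X) ∧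
  ∃ C, IsZClosed k C ∧ X = C ∩ genTuples k n m

/-- Irreducibility of a subset of `(M_n)^m` with respect to the Zariski topology. -/
def IsIrredSubset {n m : ℕ} (X : Set (MTuple k n m)) : Prop :=
  X.Nonempty ∧ ∀ C₁ C₂ : Set (MTuple k n m), IsZClosed k C₁ → IsZClosed k C₂ →
    X ⊆ C₁ ∪ C₂ → X ⊆ C₁ ∨ X ⊆ C₂

/-- The zero locus in `U_{m,n}` of a set of matrix-valued polynomials. -/
def zeroLocus {n m : ℕ} (S : Set (MatPoly k n m)) : Set (MTuple k n m) :=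
  {a | a ∈ genTuples k n m ∧ ∀ p ∈ S, evalMat k a p = 0}

/-- The zero locus in `U_{m,n}` of a two-sided ideal of a subalgebra `A` of
`M_n(k[x_{ij}^{(h)}])` (such as `G_{m,n}` or `T_{m,n}`). -/
def zeroLocusI {n m : ℕ} {A : Subalgebra k (MatPoly k n m)} (J : TwoSidedIdeal ↥A) :
    Set (MTuple k n m) :=
  {a | a ∈ genTuples k n m ∧ ∀ p : ↥A, p ∈ J → evalMat k a (p : MatPoly k n m) = 0}

/-- The vanishing (two-sided) ideal of a subset `X ⊆ (M_n)^m` in a subalgebra `A`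
of `M_n(k[x_{ij}^{(h)}])`; for `A = G_{m,n}` this is `I(X)`, for `A = T_{m,n}`
this is `I_T(X)`. -/
def vanishIdeal {n m : ℕ} (A : Subalgebra k (MatPoly k n m)) (X : Set (MTuple k n m)) :
    TwoSidedIdeal ↥A :=
  TwoSidedIdeal.mk' {p : ↥A | ∀ a ∈ X, evalMat k a (p : MatPoly k n m) = 0}
    (fun a _ => by simp)
    (fun {p q} hp hq a ha => by
      have : ((p + q : ↥A) : MatPoly k n m) = (p : MatPoly k n m) + q := rfl
      simp [this, map_add, hp a ha, hq a ha])
    (fun {p} hp a ha => by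
      have : ((-p : ↥A) : MatPoly k n m) = -(p : MatPoly k n m) := rfl
      simp [this, map_neg, hp a ha])
    (fun {p q} hq a ha => by
      have : ((p * q : ↥A) : MatPoly k n m) = (p : MatPoly k n m) * q := rfl
      simp [this, map_mul, hq a ha])
    (fun {p q} hp a ha => by
      have : ((p * q : ↥A) : MatPoly k n m) = (p : MatPoly k n m) * q := rfl
      simp [this, map_mul, hp a ha])

/-- Restriction: a matrix-valued polynomial gives an `M_n`-valued function on `X`. -/
def restrictTo {n m : ℕ} (X : Set (MTuple k n m)) :
    MatPoly k n m →ₐ[k] (X → Matrix (Fin n) (Fin n) k) :=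
  Pi.algHom k _ fun a => evalMat k a.val

/-- The PI-coordinate ring `k_n[X] = G_{m,n}/I(X)`, realized concretely as the
algebra of all restrictions to `X` of elements of `G_{m,n}` (i.e. of
`PGL_n`-equivariant morphisms `X → M_n` coming from `G_{m,n}`). -/
def coordRing {n m : ℕ} (X : Set (MTuple k n m)) :
    Subalgebra k (X → Matrix (Fin n) (Fin n) k) :=
  (GMN k n m).map (restrictTo k X)

/-- The ring `T_{m,n}/I_T(X)`, realized concretely as the algebra of all
restrictions to `X` of elements of `T_{m,n}`. -/
def coordTraceRing {n m : ℕ} (X : Set (MTuple k n m)) :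
    Subalgebra k (X → Matrix (Fin n) (Fin n) k) :=
  (TMN k n m).map (restrictTo k X)

/-- A ring is prime if it is nonzero and `a·R·b = 0` implies `a = 0` or `b = 0`. -/
def IsPrimeRing (R : Type u) [Ring R] : Prop :=
  Nontrivial R ∧ ∀ a b : R, (∀ x : R, a * x * b = 0) → a = 0 ∨ b = 0

/-- `Q` is a central simple algebra of degree `n`: a simple ring whose center is a
field, and which has dimension `n²` over its center. -/
def IsCSAOfDegree (n : ℕ) (Q : Type u) [Ring Q] : Prop :=
  IsSimpleRing Q ∧
  ∃ (K : Type u) (_ : Field K) (_ : Algebra K Q),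
    (algebraMap K Q).range = Subring.center Q ∧ Module.finrank K Q = n ^ 2

/-- A (prime PI-) ring `R` has PI-degree `n` if its total ring of fractions — the
central localization of `R` at its nonzero central elements — is a central simple
algebra of degree `n`. -/
def HasPIDegree (n : ℕ) (R : Type u) [Ring R] : Prop :=
  ∃ (Q : Type u) (_ : Ring Q) (f : R →+* Q),
    Function.Injective f ∧
    (∀ c ∈ Subring.center R, c ≠ 0 → IsUnit (f c)) ∧
    (∀ q : Q, ∃ r : R, ∃ c ∈ Subring.center R, c ≠ 0 ∧ q * f c = f r) ∧
    IsCSAOfDegree n Q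

/-- The quotient of a ring by a two-sided ideal. -/
abbrev idealQuot {R : Type u} [Ring R] (J : TwoSidedIdeal R) : Type u := J.ringCon.Quotient

/-- `Spec_n(R)`: the set of prime (two-sided) ideals `J` of `R` such that `R/J` is a
prime ring of PI-degree `n`. -/
def SpecN (n : ℕ) (R : Type u) [Ring R] : Set (TwoSidedIdeal R) :=
  {J | IsPrimeRing (idealQuot J) ∧ HasPIDegree n (idealQuot J)}

/-- A regular map of `n`-varieties `X → Y ⊆ U_{l,n}`: a map of the form
`a ↦ (f₁(a), …, f_l(a))` with each `f_i ∈ k_n[X]`, i.e. each component is the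
restriction to `X` of an element of `G_{m,n}`. -/
def IsRegMapOn {n m l : ℕ} (X : Set (MTuple k n m)) (Y : Set (MTuple k n l))
    (φ : MTuple k n m → MTuple k n l) : Prop :=
  (∀ a ∈ X, φ a ∈ Y) ∧
  ∃ F : Fin l → MatPoly k n m, (∀ i, F i ∈ GMN k n m) ∧
    ∀ a ∈ X, ∀ i, φ a i = evalMat k a (F i)

/-- `X` and `Y` are isomorphic `n`-varieties: there are mutually inverse regular
maps of `n`-varieties between them. -/
def NIsomorphic {n m l : ℕ} (X : Set (MTuple k n m)) (Y : Set (MTuple k n l)) : Prop :=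
  ∃ (φ : MTuple k n m → MTuple k n l) (ψ : MTuple k n l → MTuple k n m),
    IsRegMapOn k X Y φ ∧ IsRegMapOn k Y X ψ ∧
    (∀ a ∈ X, ψ (φ a) = a) ∧ (∀ b ∈ Y, φ (ψ b) = b)


/-- The value at `x` of the rational map of `n`-varieties with components
`c⁻¹·P_i` (`c` evaluates to scalar matrices on `U_{m,n}`, so the matrix inverse
below is the inverse of a nonzero scalar wherever `c` does not vanish). -/
def ratVal {n m l : ℕ} (P : Fin l → MatPoly k n m) (c : MatPoly k n m)
    (x : MTuple k n m) : MTuple k n l :=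
  fun i => (evalMat k x c)⁻¹ * evalMat k x (P i)

/-- `(P, c)` defines a rational map of `n`-varieties `X ⇢ Y`: the components
`c⁻¹·P_i` lie in `k_n(X)` (numerators in `G_{m,n}`, denominator a central element
of `G_{m,n}` not vanishing identically on `X`), and the map sends the locus of
`X` where `c ≠ 0` into `Y`. -/
def IsNRatMapOn {n m l : ℕ} (X : Set (MTuple k n m)) (Y : Set (MTuple k n l))
    (P : Fin l → MatPoly k n m) (c : MatPoly k n m) : Prop :=
  (∀ i, P i ∈ GMN k n m) ∧ c ∈ GMN k n m ∧
  (∀ r ∈ GMN k n m, c * r = r * c) ∧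
  (∃ x ∈ X, evalMat k x c ≠ 0) ∧
  (∀ x ∈ X, evalMat k x c ≠ 0 → ratVal k P c x ∈ Y)

/-- The rational map `(P, c) : X ⇢ Y` is dominant: its image is not contained in
any Zariski closed set not containing `Y`. -/
def IsDominantOn {n m l : ℕ} (X : Set (MTuple k n m)) (Y : Set (MTuple k n l))
    (P : Fin l → MatPoly k n m) (c : MatPoly k n m) : Prop :=
  ∀ C : Set (MTuple k n l), IsZClosed k C →
    (∀ x ∈ X, evalMat k x c ≠ 0 → ratVal k P c x ∈ C) → Y ⊆ C

/-- `X` and `Y` are birationally isomorphic `n`-varieties: there are mutually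
inverse dominant rational maps of `n`-varieties between them. -/
def NBirational {n m l : ℕ} (X : Set (MTuple k n m)) (Y : Set (MTuple k n l)) : Prop :=
  ∃ (P : Fin l → MatPoly k n m) (c : MatPoly k n m)
    (Q : Fin m → MatPoly k n l) (d : MatPoly k n l),
    IsNRatMapOn k X Y P c ∧ IsNRatMapOn k Y X Q d ∧
    IsDominantOn k X Y P c ∧ IsDominantOn k Y X Q d ∧
    (∃ x ∈ X, evalMat k x c ≠ 0 ∧ evalMat k (ratVal k P c x) d ≠ 0) ∧
    (∃ y ∈ Y, evalMat k y d ≠ 0 ∧ evalMat k (ratVal k Q d y) c ≠ 0) ∧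
    (∀ x ∈ X, evalMat k x c ≠ 0 → evalMat k (ratVal k P c x) d ≠ 0 →
      ratVal k Q d (ratVal k P c x) = x) ∧
    (∀ y ∈ Y, evalMat k y d ≠ 0 → evalMat k (ratVal k Q d y) c ≠ 0 →
      ratVal k P c (ratVal k Q d y) = y)

/-- `f : R → A` realizes `A` as the total ring of fractions of `R`, obtained by
inverting the nonzero central elements of `R`. -/
def IsTotalFracHom {R A : Type} [Ring R] [Ring A] [Algebra k R] [Algebra k A]
    (f : R →ₐ[k] A) : Prop :=
  Function.Injective f ∧
  (∀ c ∈ Subring.center R, c ≠ 0 → IsUnit (f c)) ∧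
  (∀ q : A, ∃ r : R, ∃ c ∈ Subring.center R, c ≠ 0 ∧ q * f c = f r)

noncomputable section
section PA
open scoped TensorProduct

lemma mult_dense {K A : Type} [Field K] [Ring A] [Algebra K A] (hs : IsSimpleRing A)
    (hc : (algebraMap K A).range = Subring.center A) [Module.Finite K A] (f : A →ₗ[K] A) :
    f ∈ Algebra.adjoin K (Set.range (LinearMap.mulLeft K (A := A)) ∪
      Set.range (LinearMap.mulRight K (A := A))) := by
  set R := Algebra.adjoin K (Set.range (LinearMap.mulLeft K (A := A)) ∪
      Set.range (LinearMap.mulRight K (A := A))) with hR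
  have hl : ∀ a : A, LinearMap.mulLeft K a ∈ R := fun a => Algebra.subset_adjoin (Or.inl ⟨a, rfl⟩)
  have hr : ∀ a : A, LinearMap.mulRight K a ∈ R := fun a => Algebra.subset_adjoin (Or.inr ⟨a, rfl⟩)
  have hsmul : ∀ (r : R) (x : A), r • x = (r : Module.End K A) x := fun r x => rfl
  have : IsSimpleModule R A := by
    have : Nontrivial A := inferInstance
    refine { exists_pair_ne := ⟨⊥, ⊤, bot_ne_top⟩, eq_bot_or_eq_top := fun N => ?_ }
    let I : TwoSidedIdeal A := TwoSidedIdeal.mk' (N : Set A) N.zero_mem (fun h h' => N.add_mem h h')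
      (fun {x} h => by simpa [hsmul] using N.smul_mem (-1 : R) h)
      (fun {x y} h => N.smul_mem (⟨_, hl x⟩ : R) h) (fun {x y} h => N.smul_mem (⟨_, hr y⟩ : R) h)
    have hI : ∀ x, x ∈ I ↔ x ∈ N := fun x => TwoSidedIdeal.mem_mk' _ _ _ _ _ _ _
    rcases eq_bot_or_eq_top I with h | h
    · left; ext x; rw [← hI, h]; simp [TwoSidedIdeal.mem_bot]
    · right; ext x; rw [← hI, h]; simp
  let g : Module.End (Module.End R A) A :=
    { toFun := f
      map_add' := map_add f
      map_smul' := fun φ x => by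
        have h1 : ∀ x, φ x = φ 1 * x := fun x => by
          have := φ.map_smul (⟨_, hr x⟩ : R) 1
          simpa [hsmul] using this
        have h2 : φ 1 ∈ Subring.center A := by
          rw [Subring.mem_center_iff]
          intro y
          have := φ.map_smul (⟨_, hl y⟩ : R) 1
          simp [hsmul] at this
          rw [← this, h1]
        rw [← hc] at h2
        obtain ⟨κ, hκ⟩ := h2
        simp only [RingHom.id_apply, Module.End.smul_def]
        rw [h1, h1 (f x), ← hκ, ← Algebra.smul_def, ← Algebra.smul_def, map_smul] }
  obtain ⟨s, hs⟩ := Module.Finite.fg_top (R := K) (M := A)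
  obtain ⟨r, hr'⟩ := jacobson_density (R := R) (M := A) g s
  have : f = (r : Module.End K A) := by
    refine LinearMap.ext_on hs ?_
    intro x hx
    exact hr' x hx
  rw [this]; exact r.2

lemma tensor_simple {K A : Type} [Field K] [Ring A] [Algebra K A] (hs : IsSimpleRing A)
    (hc : (algebraMap K A).range = Subring.center A) [Module.Finite K A]
    (L : Type) [Field L] [Algebra K L] : IsSimpleRing (L ⊗[K] A) := by
  have : Nontrivial (L ⊗[K] A) := inferInstance
  refine ⟨⟨fun I => ?_⟩⟩
  by_contra! hI
  obtain ⟨hI0, hI1⟩ := hI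
  have aux1 : ∀ (a : A) (x : L ⊗[K] A), (LinearMap.mulLeft K a).lTensor L x = (1 ⊗ₜ a) * x := by
    intro a x
    induction x using TensorProduct.induction_on with
    | zero => simp
    | tmul u v => simp
    | add u v hu hv => simp only [map_add, mul_add, hu, hv]
  have aux2 : ∀ (a : A) (x : L ⊗[K] A), (LinearMap.mulRight K a).lTensor L x = x * (1 ⊗ₜ a) := by
    intro a x
    induction x using TensorProduct.induction_on with
    | zero => simp
    | tmul u v => simp
    | add u v hu hv => simp only [map_add, add_mul, hu, hv]
  have key : ∀ f : A →ₗ[K] A, ∀ x ∈ I, f.lTensor L x ∈ I := by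
    intro f
    have hf := mult_dense hs hc f
    induction hf using Algebra.adjoin_induction with
    | mem g hg =>
      rcases hg with ⟨a, rfl⟩ | ⟨a, rfl⟩
      · intro x hx
        have : (LinearMap.mulLeft K a).lTensor L x = (1 ⊗ₜ a) * x := aux1 a x
        rw [this]; exact I.mul_mem_left _ _ hx
      · intro x hx
        have : (LinearMap.mulRight K a).lTensor L x = x * (1 ⊗ₜ a) := aux2 a x
        rw [this]; exact I.mul_mem_right _ _ hx
    | algebraMap r =>
      intro x hx
      have : (algebraMap K (Module.End K A) r).lTensor L x = algebraMap K (L ⊗[K] A) r * x := by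
        rw [← Algebra.smul_def, Module.algebraMap_end_eq_smul_id, LinearMap.lTensor_smul]
        simp
      rw [this]; exact I.mul_mem_left _ _ hx
    | add f g _ _ hf hg =>
      intro x hx; rw [LinearMap.lTensor_add]; exact I.add_mem (hf x hx) (hg x hx)
    | mul f g _ _ hf hg =>
      intro x hx
      have : (f * g).lTensor L x = f.lTensor L (g.lTensor L x) := by
        rw [LinearMap.lTensor_mul]; rfl
      rw [this]; exact hf _ (hg x hx)
  obtain ⟨x, hx, hx0⟩ : ∃ x ∈ I, x ≠ 0 := by
    by_contra! h
    exact hI0 (le_antisymm (fun x hx => by simpa using h x hx) bot_le)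
  let b := Module.finBasis K A
  let B := b.baseChange L
  obtain ⟨i, hi⟩ : ∃ i, B.repr x i ≠ 0 := by
    by_contra! h
    exact hx0 (B.repr.map_eq_zero_iff.mp (by ext i; simpa using h i))
  let f : A →ₗ[K] A := (b.coord i).smulRight 1
  have hf : ∀ x, f.lTensor L x = (B.repr x i) ⊗ₜ 1 := by
    intro x
    induction x using TensorProduct.induction_on with
    | zero => simp
    | tmul u v =>
      simp [f, B, TensorProduct.tmul_smul, TensorProduct.smul_tmul', Module.Basis.baseChange_repr_tmul]
    | add u v hu hv => simp only [map_add, hu, hv, Finsupp.add_apply, TensorProduct.add_tmul]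
  have h1 := key f x hx
  rw [hf] at h1
  have h2 := I.mul_mem_left ((B.repr x i)⁻¹ ⊗ₜ 1) _ h1
  rw [Algebra.TensorProduct.tmul_mul_tmul, inv_mul_cancel₀ hi, mul_one,
    ← Algebra.TensorProduct.one_def] at h2
  exact hI1 ((TwoSidedIdeal.one_mem_iff _).mp h2)

lemma exists_split {K A : Type} [Field K] [Ring A] [Algebra K A] (hs : IsSimpleRing A)
    (hc : (algebraMap K A).range = Subring.center A) (n : ℕ) (hn : 1 ≤ n)
    (hdeg : Module.finrank K A = n ^ 2) :
    ∃ β : A →ₐ[K] Matrix (Fin n) (Fin n) (AlgebraicClosure K),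
      Submodule.span (AlgebraicClosure K) (Set.range β) = ⊤ := by
  set L := AlgebraicClosure K
  have : Module.Finite K A := Module.finite_of_finrank_pos (by rw [hdeg]; positivity)
  have := tensor_simple hs hc L
  obtain ⟨d, _, ⟨e⟩⟩ := IsSimpleRing.exists_algEquiv_matrix_of_isAlgClosed L (L ⊗[K] A)
  have h1 := e.toLinearEquiv.finrank_eq
  rw [Module.finrank_baseChange, hdeg, Module.finrank_matrix] at h1
  have hd : d = n := by
    simp at h1
    have : n ^ 2 = d ^ 2 := by rw [h1]; ring
    exact (Nat.pow_left_injective (n := 2) (by norm_num) this).symm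
  subst hd
  refine ⟨(e.toAlgHom.restrictScalars K).comp Algebra.TensorProduct.includeRight, ?_⟩
  rw [eq_top_iff]
  intro M _
  obtain ⟨t, rfl⟩ := e.surjective M
  induction t using TensorProduct.induction_on with
  | zero => simp
  | tmul u v =>
    have : u ⊗ₜ[K] v = u • ((1 : L) ⊗ₜ[K] v) := by simp [TensorProduct.smul_tmul']
    rw [this, map_smul]
    exact Submodule.smul_mem _ _ (Submodule.subset_span ⟨v, rfl⟩)
  | add u v hu hv => rw [map_add]; exact Submodule.add_mem _ (hu trivial) (hv trivial)

end PA
end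

noncomputable section
section PB

/-- Evaluation at a tuple of matrices over a commutative `k`-algebra. -/
def gev {n m : ℕ} {E : Type} [CommRing E] [Algebra k E] (y : Fin m → Matrix (Fin n) (Fin n) E) :
    PolyRing k n m →ₐ[k] E :=
  MvPolynomial.aeval fun x : MIdx n m => y x.1 x.2.1 x.2.2

def gevM {n m : ℕ} {E : Type} [CommRing E] [Algebra k E] (y : Fin m → Matrix (Fin n) (Fin n) E) :
    MatPoly k n m →ₐ[k] Matrix (Fin n) (Fin n) E :=
  (gev k y).mapMatrix

lemma gevM_generic {n m : ℕ} {E : Type} [CommRing E] [Algebra k E]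
    (y : Fin m → Matrix (Fin n) (Fin n) E) (h : Fin m) : gevM k y (genericMatrix k n m h) = y h := by
  ext i j; simp [gevM, gev, genericMatrix]

lemma evalMat_eq_gevM {n m : ℕ} (a : MTuple k n m) : evalMat k a = gevM k a := rfl
lemma polyEval_eq_gev {n m : ℕ} (a : MTuple k n m) : polyEval k a = gev k a := rfl

lemma gev_comp {n m : ℕ} {E E' : Type} [CommRing E] [Algebra k E] [CommRing E'] [Algebra k E']
    (φ : E →ₐ[k] E') (y : Fin m → Matrix (Fin n) (Fin n) E) (q : PolyRing k n m) :
    φ (gev k y q) = gev k (fun i => (y i).map φ) q := by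
  have : φ.comp (gev k y) = gev k (fun i => (y i).map φ) := by
    ext x; simp [gev]
  exact congrArg (fun f => f q) this

lemma homogenize {n m : ℕ} {R : Type} [CommRing R] [Algebra k R]
    (P : Fin m → Matrix (Fin n) (Fin n) R) (s : R) (q : PolyRing k n m) :
    ∃ (N : ℕ) (t : R), ∀ (E : Type) [Field E] [Algebra k E] (φ : R →ₐ[k] E), φ s ≠ 0 →
      φ t = φ s ^ N * gev k (fun i => (φ s)⁻¹ • (P i).map φ) q := by
  induction q using MvPolynomial.induction_on with
  | C a => exact ⟨0, algebraMap k R a, fun E _ _ φ _ => by simp [gev]⟩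
  | add p q hp hq =>
    obtain ⟨N, t, h⟩ := hp
    obtain ⟨N', t', h'⟩ := hq
    refine ⟨N + N', t * s ^ N' + t' * s ^ N, fun E _ _ φ hs => ?_⟩
    simp only [map_add, map_mul, map_pow, h E φ hs, h' E φ hs]; ring
  | mul_X p x hp =>
    obtain ⟨N, t, h⟩ := hp
    refine ⟨N + 1, t * P x.1 x.2.1 x.2.2, fun E _ _ φ hs => ?_⟩
    simp only [map_mul, h E φ hs, pow_succ]
    simp [gev]
    field_simp

lemma conj_poly {n m : ℕ} {Ω : Type} [Field Ω] [Algebra k Ω]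
    (ξ : Fin m → Matrix (Fin n) (Fin n) Ω) (q : PolyRing k n m) :
    ∃ F : MvPolynomial (Fin n × Fin n) Ω, ∀ g : Matrix (Fin n) (Fin n) Ω, g.det ≠ 0 →
      (MvPolynomial.eval (fun x => g x.1 x.2) F = 0 ↔ gev k (fun i => g * ξ i * g⁻¹) q = 0) := by
  let X := Matrix.mvPolynomialX (Fin n) (Fin n) Ω
  obtain ⟨N, t, h⟩ := homogenize k (R := MvPolynomial (Fin n × Fin n) Ω)
    (fun i => X * (ξ i).map MvPolynomial.C * X.adjugate) X.det q
  refine ⟨t, fun g hg => ?_⟩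
  let φ : MvPolynomial (Fin n × Fin n) Ω →ₐ[k] Ω :=
    (MvPolynomial.aeval (R := Ω) (fun x : Fin n × Fin n => g x.1 x.2)).restrictScalars k
  have hφ : ∀ p, φ p = MvPolynomial.eval (fun x => g x.1 x.2) p := fun p => by
    simp [φ, MvPolynomial.aeval_eq_eval]
  have hX : X.map φ = g := by
    ext i j; simp [X, hφ]
  have hX' : (φ : MvPolynomial (Fin n × Fin n) Ω →+* Ω).mapMatrix X = g := hX
  have hdet : φ X.det = g.det := by
    have := RingHom.map_det (φ : MvPolynomial (Fin n × Fin n) Ω →+* Ω) X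
    rw [hX'] at this; exact this
  have hadj : X.adjugate.map φ = g.adjugate := by
    have := RingHom.map_adjugate (φ : MvPolynomial (Fin n × Fin n) Ω →+* Ω) X
    rw [hX'] at this; exact this
  have h1 := h Ω φ (by rwa [hdet])
  rw [← hφ, h1, hdet]
  have h2 : (fun i => (g.det)⁻¹ • (X * (ξ i).map MvPolynomial.C * X.adjugate).map φ)
      = fun i => g * ξ i * g⁻¹ := by
    funext i
    have h3 : ((ξ i).map MvPolynomial.C).map φ = ξ i := by ext a b; simp [hφ]
    rw [Matrix.map_mul, Matrix.map_mul, hX, hadj, h3, Matrix.inv_def, Ring.inverse_eq_inv',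
      Matrix.mul_smul]
  rw [h2]
  simp [hg]

lemma poly_zero_of_GL {n : ℕ} {Ω : Type} [Field Ω] [Algebra k Ω]
    (F : MvPolynomial (Fin n × Fin n) Ω)
    (h : ∀ g : GL (Fin n) k, MvPolynomial.eval
      (fun x => algebraMap k Ω ((g : Matrix (Fin n) (Fin n) k) x.1 x.2)) F = 0) : F = 0 := by
  have hdet := Matrix.det_mvPolynomialX_ne_zero (Fin n) Ω
  suffices F * (Matrix.mvPolynomialX (Fin n) (Fin n) Ω).det = 0 from
    (mul_eq_zero.mp this).resolve_right hdet
  have hinf : (Set.range (algebraMap k Ω)).Infinite := by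
    have : Infinite k := inferInstance
    exact Set.infinite_range_of_injective (algebraMap k Ω).injective
  refine MvPolynomial.funext_set (fun _ => Set.range (algebraMap k Ω)) (fun _ => hinf) ?_
  intro x hx
  choose y hy using fun i => hx i trivial
  have hx' : x = fun i => algebraMap k Ω (y i) := by funext i; exact (hy i).symm
  let g : Matrix (Fin n) (Fin n) k := Matrix.of fun i j => y (i, j)
  rw [map_mul, map_zero]
  by_cases hg : g.det = 0
  · have : MvPolynomial.eval x (Matrix.mvPolynomialX (Fin n) (Fin n) Ω).det = 0 := by
      rw [RingHom.map_det]
      have : (MvPolynomial.eval x).mapMatrix (Matrix.mvPolynomialX (Fin n) (Fin n) Ω)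
          = (algebraMap k Ω).mapMatrix g := by
        ext i j; simp [g, hx']
      rw [this, ← RingHom.map_det, hg, map_zero]
    rw [this, mul_zero]
  · have := h (Matrix.GeneralLinearGroup.mkOfDetNeZero g hg)
    have h2 : x = fun x => algebraMap k Ω
        ((Matrix.GeneralLinearGroup.mkOfDetNeZero g hg : Matrix (Fin n) (Fin n) k) x.1 x.2) := by
      rw [hx']; funext i; rfl
    rw [h2, this, zero_mul]

/-- base change of an invertible matrix -/
def gmap {n : ℕ} (Ω : Type) [Field Ω] [Algebra k Ω] (g : GL (Fin n) k) :
    Matrix (Fin n) (Fin n) Ω := (g : Matrix (Fin n) (Fin n) k).map (algebraMap k Ω)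

lemma gmap_det {n : ℕ} (Ω : Type) [Field Ω] [Algebra k Ω] (g : GL (Fin n) k) :
    (gmap k Ω g).det ≠ 0 := by
  have : (gmap k Ω g).det = algebraMap k Ω (g : Matrix (Fin n) (Fin n) k).det := by
    rw [RingHom.map_det]; rfl
  rw [this]
  have : (g : Matrix (Fin n) (Fin n) k).det ≠ 0 := g.det_ne_zero
  simpa using this

lemma conj_density {n m : ℕ} {Ω : Type} [Field Ω] [Algebra k Ω]
    (ξ : Fin m → Matrix (Fin n) (Fin n) Ω) (q : PolyRing k n m)
    (h : ∀ g : GL (Fin n) k, gev k (fun i => gmap k Ω g * ξ i * (gmap k Ω g)⁻¹) q = 0)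
    (g : Matrix (Fin n) (Fin n) Ω) (hg : g.det ≠ 0) :
    gev k (fun i => g * ξ i * g⁻¹) q = 0 := by
  obtain ⟨F, hF⟩ := conj_poly k ξ q
  have : F = 0 := poly_zero_of_GL k F fun g => (hF _ (gmap_det k Ω g)).mpr (h g)
  rw [← hF g hg, this, map_zero]

/-- polynomials vanishing on the orbit of a point form a prime ideal -/
lemma orbit_prime {n m : ℕ} {Ω : Type} [Field Ω] [Algebra k Ω]
    (ξ : Fin m → Matrix (Fin n) (Fin n) Ω) (p q : PolyRing k n m)
    (h : ∀ g : GL (Fin n) k, gev k (fun i => gmap k Ω g * ξ i * (gmap k Ω g)⁻¹) (p * q) = 0) :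
    (∀ g : GL (Fin n) k, gev k (fun i => gmap k Ω g * ξ i * (gmap k Ω g)⁻¹) p = 0) ∨
    (∀ g : GL (Fin n) k, gev k (fun i => gmap k Ω g * ξ i * (gmap k Ω g)⁻¹) q = 0) := by
  obtain ⟨F, hF⟩ := conj_poly k ξ p
  obtain ⟨F', hF'⟩ := conj_poly k ξ q
  have : F * F' = 0 := by
    refine poly_zero_of_GL k _ fun g => ?_
    have h1 := h g
    rw [map_mul, mul_eq_zero, ← hF _ (gmap_det k Ω g), ← hF' _ (gmap_det k Ω g)] at h1
    rw [map_mul]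
    exact mul_eq_zero.mpr h1
  rcases mul_eq_zero.mp this with h0 | h0
  · left; intro g; rw [← hF _ (gmap_det k Ω g), h0, map_zero]
  · right; intro g; rw [← hF' _ (gmap_det k Ω g), h0, map_zero]
end PB
end

noncomputable section
section PC
set_option linter.unusedSectionVars false

lemma det_trace {R M ι : Type} [CommRing R] [AddCommGroup M] [Module R M] [Fintype ι] [DecidableEq ι]
    (e : Module.Basis ι R M) (T : M →ₗ[R] M) (u : ι → M) :
    ∑ i, e.det (Function.update u i (T (u i))) = (LinearMap.toMatrix e e T).trace * e.det u := by
  set A := e.toMatrix u with hA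
  have h1 : ∀ i, e.det (Function.update u i (T (u i))) =
      (A.adjugate * (LinearMap.toMatrix e e T * A)) i i := by
    intro i
    rw [Module.Basis.det_apply, Module.Basis.toMatrix_update, ← Matrix.cramer_apply,
      Matrix.cramer_eq_adjugate_mulVec, Matrix.mul_apply_eq_vecMul]
    have : ⇑(e.repr (T (u i))) = (LinearMap.toMatrix e e T * A).col i := by
      rw [← LinearMap.toMatrix_mulVec_repr e e T (u i)]
      ext j; simp [Matrix.mul_apply, Matrix.mulVec, dotProduct, A, Module.Basis.toMatrix_apply]
    rw [this]
    simp [Matrix.mulVec, Matrix.vecMul, dotProduct, Matrix.mul_apply, ← hA]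
  have h2 : ∑ i, e.det (Function.update u i (T (u i))) =
      (A.adjugate * (LinearMap.toMatrix e e T * A)).trace := by
    simp only [h1, Matrix.trace, Matrix.diag_apply]
  rw [h2, Matrix.trace_mul_comm, Matrix.mul_assoc, Matrix.mul_adjugate, Module.Basis.det_apply]
  simp [mul_comm, A]

lemma alt_trace {R ι : Type} {n : ℕ} [CommRing R] [Fintype ι] [DecidableEq ι]
    (e : Module.Basis ι R (Matrix (Fin n) (Fin n) R))
    (f : (Matrix (Fin n) (Fin n) R) [⋀^ι]→ₗ[R] (Matrix (Fin n) (Fin n) R))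
    (T : Matrix (Fin n) (Fin n) R →ₗ[R] Matrix (Fin n) (Fin n) R)
    (u : ι → Matrix (Fin n) (Fin n) R) :
    ∑ i, f (Function.update u i (T (u i))) = (LinearMap.toMatrix e e T).trace • f u := by
  ext a b
  let g := (Matrix.entryLinearMap R R a b).compAlternatingMap f
  have hg : ∀ v, f v a b = g v := fun v => rfl
  have h1 : ∀ v, g v = g e * e.det v := fun v => by
    conv_lhs => rw [g.eq_smul_basis_det e]
    simp
  rw [Matrix.sum_apply, Matrix.smul_apply]
  simp only [hg]
  simp only [h1 u, h1 (Function.update _ _ _)]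
  rw [← Finset.mul_sum, det_trace]
  simp only [smul_eq_mul]; ring

lemma trace_mulLeft' {R : Type} {n : ℕ} [CommRing R] (x : Matrix (Fin n) (Fin n) R) :
    (LinearMap.toMatrix (Matrix.stdBasis R (Fin n) (Fin n)) (Matrix.stdBasis R (Fin n) (Fin n))
      (LinearMap.mulLeft R x)).trace = n * x.trace := by
  simp only [Matrix.trace, Matrix.diag_apply, LinearMap.toMatrix_apply, Fintype.sum_prod_type,
    Matrix.stdBasis_eq_single, LinearMap.mulLeft_apply]
  have : ∀ a b : Fin n, ((Matrix.stdBasis R (Fin n) (Fin n)).repr (x * Matrix.single a b 1)) (a, b)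
      = x a a := by
    intro a b
    simp [Matrix.stdBasis, Matrix.mul_apply, Matrix.single_apply]
  simp only [this]
  simp [Finset.mul_sum]

/-- The Capelli-type polynomial. -/
def cap {B : Type} [Ring B] (N : ℕ) (p q u : Fin N → B) : B :=
  ∑ σ : Equiv.Perm (Fin N), Equiv.Perm.sign σ • (List.ofFn fun i => p i * u (σ i) * q i).prod

lemma map_cap {B B' : Type} [Ring B] [Ring B'] (φ : B →+* B') (N : ℕ) (p q u : Fin N → B) :
    φ (cap N p q u) = cap N (fun i => φ (p i)) (fun i => φ (q i)) (fun i => φ (u i)) := by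
  simp only [cap, map_sum, Units.smul_def, map_zsmul, map_list_prod, List.map_ofFn, Function.comp_def, map_mul]

def capAlt {R : Type} {n : ℕ} [CommRing R] (N : ℕ) (p q : Fin N → Matrix (Fin n) (Fin n) R) :
    (Matrix (Fin n) (Fin n) R) [⋀^Fin N]→ₗ[R] (Matrix (Fin n) (Fin n) R) :=
  MultilinearMap.alternatization
    ((MultilinearMap.mkPiAlgebraFin R N (Matrix (Fin n) (Fin n) R)).compLinearMap
      fun i => (LinearMap.mulLeft R (p i)) ∘ₗ (LinearMap.mulRight R (q i)))

lemma capAlt_apply {R : Type} {n : ℕ} [CommRing R] (N : ℕ) (p q u : Fin N → Matrix (Fin n) (Fin n) R) :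
    capAlt N p q u = cap N p q u := by
  simp [capAlt, cap, MultilinearMap.alternatization_apply, mul_assoc]

lemma cap_trace {R : Type} {n : ℕ} [CommRing R]
    (p q u : Fin (n * n) → Matrix (Fin n) (Fin n) R) (x : Matrix (Fin n) (Fin n) R) :
    ∑ i, cap (n * n) p q (Function.update u i (x * u i)) = (n * x.trace) • cap (n * n) p q u := by
  let b := Matrix.stdBasis R (Fin n) (Fin n)
  let e := b.reindex finProdFinEquiv
  have := alt_trace e (capAlt (n * n) p q) (LinearMap.mulLeft R x) u
  simp only [capAlt_apply, LinearMap.mulLeft_apply] at this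
  rw [this, ← trace_mulLeft']
  congr 1
  rw [← LinearMap.trace_eq_matrix_trace, ← LinearMap.trace_eq_matrix_trace]

lemma cap_unit {R : Type} {n : ℕ} [CommRing R] (hn : 1 ≤ n) (o : Fin n) :
    cap (n * n) (fun i => Matrix.single o (finProdFinEquiv.symm i).1 (1 : R))
      (fun i => Matrix.single (finProdFinEquiv.symm i).2 o (1 : R))
      (fun i => Matrix.single (finProdFinEquiv.symm i).1 (finProdFinEquiv.symm i).2 (1 : R))
      = Matrix.single o o 1 := by
  have hpow : (Matrix.single o o (1 : R)) ^ (n * n) = Matrix.single o o 1 := by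
    refine IsIdempotentElem.pow_eq ?_ ?_
    · simp [IsIdempotentElem]
    · have : 0 < n * n := by positivity
      omega
  have hprod : ∀ σ : Equiv.Perm (Fin (n * n)), (List.ofFn fun i : Fin (n * n) =>
      Matrix.single o (finProdFinEquiv.symm i).1 (1 : R) *
      Matrix.single (finProdFinEquiv.symm (σ i)).1 (finProdFinEquiv.symm (σ i)).2 (1 : R) *
      Matrix.single (finProdFinEquiv.symm i).2 o (1 : R)).prod =
      (if σ = 1 then 1 else 0 : R) • Matrix.single o o 1 := by
    intro σ
    have h1 : (fun i : Fin (n * n) => Matrix.single o (finProdFinEquiv.symm i).1 (1 : R) *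
      Matrix.single (finProdFinEquiv.symm (σ i)).1 (finProdFinEquiv.symm (σ i)).2 (1 : R) *
      Matrix.single (finProdFinEquiv.symm i).2 o (1 : R)) =
      fun i => (if σ i = i then 1 else 0 : R) • Matrix.single o o 1 := by
      funext i
      by_cases h : σ i = i
      · simp [h]
      · rw [if_neg h, zero_smul]
        by_cases h2 : (finProdFinEquiv.symm i).1 = (finProdFinEquiv.symm (σ i)).1
        · have h3 : (finProdFinEquiv.symm (σ i)).2 ≠ (finProdFinEquiv.symm i).2 := fun h3 =>
            h (finProdFinEquiv.symm.injective (Prod.ext h2.symm h3))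
          rw [Matrix.mul_assoc, Matrix.single_mul_single_of_ne _ _ _ _ h3, Matrix.mul_zero]
        · rw [Matrix.single_mul_single_of_ne _ _ _ _ h2, Matrix.zero_mul]
    rw [h1]
    have := (MultilinearMap.mkPiAlgebraFin R (n * n) (Matrix (Fin n) (Fin n) R)).map_smul_univ
      (fun i => (if σ i = i then 1 else 0 : R)) (fun _ => Matrix.single o o 1)
    rw [MultilinearMap.mkPiAlgebraFin_apply, MultilinearMap.mkPiAlgebraFin_apply_const, hpow] at this
    rw [this]
    congr 1
    by_cases h : σ = 1
    · simp [h]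
    · rw [if_neg h]
      obtain ⟨i, hi⟩ : ∃ i, σ i ≠ i := by
        by_contra! hh
        exact h (Equiv.ext hh)
      exact Finset.prod_eq_zero (Finset.mem_univ i) (if_neg hi)
  unfold cap
  rw [Finset.sum_eq_single 1]
  · rw [hprod]; simp
  · intro σ _ hσ; rw [hprod]; simp [hσ]
  · simp

def swapMat (R : Type) [CommRing R] (n : ℕ) : Matrix (Fin n × Fin n) (Fin n × Fin n) R :=
  Matrix.of fun x y => if x.1 = y.2 ∧ x.2 = y.1 then 1 else 0

lemma swapMat_sq (R : Type) [CommRing R] (n : ℕ) : swapMat R n * swapMat R n = 1 := by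
  ext ⟨a, b⟩ ⟨c, d⟩
  rw [Matrix.mul_apply, Finset.sum_eq_single (b, a)]
  · simp [swapMat, Matrix.one_apply, and_comm]
  · rintro ⟨x, y⟩ _ h
    have : ¬ (a = y ∧ b = x) := fun hh => h (by rw [hh.1, hh.2])
    simp [swapMat, this]
  · simp

lemma sum4 {R I J : Type} [CommRing R] [Fintype I] [Fintype J] (F : I → I → J → J → R) :
    ∑ i, ∑ j, ∑ d, ∑ c, F i j d c = ∑ d, ∑ c, ∑ j, ∑ i, F i j d c := by
  calc _ = ∑ i, ∑ d, ∑ j, ∑ c, F i j d c := Finset.sum_congr rfl fun i _ => Finset.sum_comm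
    _ = ∑ d, ∑ i, ∑ j, ∑ c, F i j d c := Finset.sum_comm
    _ = ∑ d, ∑ j, ∑ i, ∑ c, F i j d c := Finset.sum_congr rfl fun i _ => Finset.sum_comm
    _ = ∑ d, ∑ j, ∑ c, ∑ i, F i j d c := Finset.sum_congr rfl fun i _ =>
        Finset.sum_congr rfl fun i _ => Finset.sum_comm
    _ = _ := Finset.sum_congr rfl fun i _ => Finset.sum_comm

lemma gram_identity {R : Type} [CommRing R] {n : ℕ} (w : Fin n × Fin n → Matrix (Fin n) (Fin n) R)
    (M : Matrix (Fin n) (Fin n) R) :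
    ∑ i, ∑ j, (Matrix.of fun i j => (w i * w j).trace).adjugate i j • (w i * M * w j) =
      algebraMap R (Matrix (Fin n) (Fin n) R)
        (((Matrix.of fun i x => w i x.1 x.2).det ^ 2 * (swapMat R n).det) * M.trace) := by
  set A : Matrix (Fin n × Fin n) (Fin n × Fin n) R := Matrix.of fun i x => w i x.1 x.2 with hA
  set G : Matrix (Fin n × Fin n) (Fin n × Fin n) R := Matrix.of fun i j => (w i * w j).trace with hG
  have hAτ : ∀ i x, (A * swapMat R n) i x = w i x.2 x.1 := by
    rintro i ⟨a, b⟩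
    rw [Matrix.mul_apply, Finset.sum_eq_single (b, a)]
    · simp [swapMat, A]
    · rintro ⟨x, y⟩ _ h
      have : ¬ (x = b ∧ y = a) := fun hh => h (by rw [hh.1, hh.2])
      simp [swapMat, this]
    · simp
  have hGA : G = A * swapMat R n * A.transpose := by
    ext i j
    rw [Matrix.mul_apply]
    simp only [hAτ, G, Matrix.of_apply, Matrix.trace, Matrix.diag_apply, Matrix.mul_apply,
      Matrix.transpose_apply, A, Fintype.sum_prod_type]
    rw [Finset.sum_comm]
  have hadjτ : (swapMat R n).adjugate = (swapMat R n).det • swapMat R n := by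
    have h1 := Matrix.adjugate_mul (swapMat R n)
    calc (swapMat R n).adjugate = (swapMat R n).adjugate * (swapMat R n) * (swapMat R n) := by
          rw [Matrix.mul_assoc, swapMat_sq, Matrix.mul_one]
      _ = _ := by rw [h1, Matrix.smul_mul, Matrix.one_mul]
  have hkey : A.transpose * G.adjugate * A = (A.det ^ 2 * (swapMat R n).det) • swapMat R n := by
    rw [hGA, Matrix.adjugate_mul_distrib, Matrix.adjugate_mul_distrib]
    have : A.transpose * (A.transpose.adjugate * ((swapMat R n).adjugate * A.adjugate)) * A =
      (A.transpose * A.transpose.adjugate) * (swapMat R n).adjugate * (A.adjugate * A) := by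
      simp only [Matrix.mul_assoc]
    rw [this, Matrix.mul_adjugate, Matrix.adjugate_mul, hadjτ, Matrix.det_transpose]
    simp only [Matrix.smul_mul, Matrix.mul_smul, Matrix.one_mul, Matrix.mul_one, smul_smul]
    congr 1; ring
  ext α β
  have hL : (∑ i, ∑ j, G.adjugate i j • (w i * M * w j)) α β =
      ∑ d, ∑ c, M c d * (A.transpose * G.adjugate * A) (α, c) (d, β) := by
    simp only [Matrix.sum_apply, Matrix.smul_apply, Matrix.mul_apply, Matrix.transpose_apply, smul_eq_mul,
      Finset.mul_sum, Finset.sum_mul]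
    rw [sum4]
    refine Finset.sum_congr rfl fun d _ => Finset.sum_congr rfl fun c _ =>
      Finset.sum_congr rfl fun j _ => Finset.sum_congr rfl fun i _ => ?_
    simp only [A, Matrix.of_apply]; ring
  rw [hL, hkey]
  simp only [Matrix.smul_apply, swapMat, Matrix.of_apply, Matrix.algebraMap_matrix_apply, smul_eq_mul]
  by_cases h : α = β
  · subst h
    simp [Matrix.trace, Finset.mul_sum, Finset.sum_mul, mul_comm]
  · simp [h]
end PC
end

noncomputable section
section PD
set_option linter.unusedSectionVars false

def CapS (n m : ℕ) : Submodule k (MatPoly k n m) :=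
  Submodule.span k {z | ∃ a ∈ GMN k n m, ∃ b ∈ GMN k n m, ∃ p q u : Fin (n * n) → MatPoly k n m,
    (∀ i, p i ∈ GMN k n m) ∧ (∀ i, q i ∈ GMN k n m) ∧ (∀ i, u i ∈ GMN k n m) ∧
      z = a * cap (n * n) p q u * b}

lemma cap_mem {n m : ℕ} {N : ℕ} (p q u : Fin N → MatPoly k n m)
    (hp : ∀ i, p i ∈ GMN k n m) (hq : ∀ i, q i ∈ GMN k n m) (hu : ∀ i, u i ∈ GMN k n m) :
    cap N p q u ∈ GMN k n m := by
  refine Subalgebra.sum_mem _ fun σ _ => ?_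
  rw [Units.smul_def]
  refine (GMN k n m).toSubring.zsmul_mem ?_ _
  refine (GMN k n m).toSubring.list_prod_mem ?_
  intro x hx
  rw [List.mem_ofFn] at hx
  obtain ⟨i, rfl⟩ := hx
  exact Subalgebra.mul_mem _ (Subalgebra.mul_mem _ (hp _) (hu _)) (hq _)

lemma CapS_le {n m : ℕ} {z : MatPoly k n m} (hz : z ∈ CapS k n m) : z ∈ GMN k n m := by
  refine Submodule.span_induction (p := fun z _ => z ∈ GMN k n m) ?_ ?_ ?_ ?_ hz
  · rintro z ⟨a, ha, b, hb, p, q, u, hp, hq, hu, rfl⟩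
    exact Subalgebra.mul_mem _ (Subalgebra.mul_mem _ ha (cap_mem k p q u hp hq hu)) hb
  · exact Subalgebra.zero_mem _
  · intro x y _ _ hx hy; exact Subalgebra.add_mem _ hx hy
  · intro a x _ hx; exact Subalgebra.smul_mem _ hx a

lemma CapS_mul_left {n m : ℕ} {z x : MatPoly k n m} (hx : x ∈ GMN k n m) (hz : z ∈ CapS k n m) :
    x * z ∈ CapS k n m := by
  refine Submodule.span_induction (p := fun z _ => x * z ∈ CapS k n m) ?_ ?_ ?_ ?_ hz
  · rintro z ⟨a, ha, b, hb, p, q, u, hp, hq, hu, rfl⟩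
    exact Submodule.subset_span ⟨x * a, Subalgebra.mul_mem _ hx ha, b, hb, p, q, u, hp, hq, hu,
      by simp only [mul_assoc]⟩
  · simp
  · intro x y _ _ hx hy; rw [mul_add]; exact Submodule.add_mem _ hx hy
  · intro a x _ hx; rw [mul_smul_comm]; exact Submodule.smul_mem _ a hx

lemma CapS_mul_right {n m : ℕ} {z x : MatPoly k n m} (hx : x ∈ GMN k n m) (hz : z ∈ CapS k n m) :
    z * x ∈ CapS k n m := by
  refine Submodule.span_induction (p := fun z _ => z * x ∈ CapS k n m) ?_ ?_ ?_ ?_ hz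
  · rintro z ⟨a, ha, b, hb, p, q, u, hp, hq, hu, rfl⟩
    exact Submodule.subset_span ⟨a, ha, b * x, Subalgebra.mul_mem _ hb hx, p, q, u, hp, hq, hu,
      by simp only [mul_assoc]⟩
  · simp
  · intro x y _ _ hx hy; rw [add_mul]; exact Submodule.add_mem _ hx hy
  · intro a x _ hx; rw [smul_mul_assoc]; exact Submodule.smul_mem _ a hx

lemma CapS_trace {n m : ℕ} (hn : 1 ≤ n) {z x : MatPoly k n m} (hx : x ∈ GMN k n m)
    (hz : z ∈ CapS k n m) : x.trace • z ∈ CapS k n m := by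
  refine Submodule.span_induction (p := fun z _ => x.trace • z ∈ CapS k n m) ?_ ?_ ?_ ?_ hz
  · rintro z ⟨a, ha, b, hb, p, q, u, hp, hq, hu, rfl⟩
    have h := cap_trace p q u x
    have h2 : x.trace • (a * cap (n * n) p q u * b) =
        (n : k)⁻¹ • ∑ i, a * cap (n * n) p q (Function.update u i (x * u i)) * b := by
      rw [← Finset.sum_mul, ← Finset.mul_sum, h, Matrix.mul_smul, Matrix.smul_mul, mul_smul]
      have h3 : (n : PolyRing k n m) = algebraMap k _ (n : k) := by simp
      rw [h3, algebraMap_smul, smul_smul, inv_mul_cancel₀, one_smul]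
      exact_mod_cast (by omega : n ≠ 0)
    rw [h2]
    refine Submodule.smul_mem _ _ (Submodule.sum_mem _ fun i _ => Submodule.subset_span
      ⟨a, ha, b, hb, p, q, _, hp, hq, ?_, rfl⟩)
    intro j
    by_cases hj : j = i
    · subst hj; simpa using Subalgebra.mul_mem _ hx (hu _)
    · simpa [hj] using hu j
  · simp
  · intro x y _ _ hx hy; rw [smul_add]; exact Submodule.add_mem _ hx hy
  · intro a z _ hz; rw [smul_comm]; exact Submodule.smul_mem _ a hz

def TrS (n m : ℕ) : Subalgebra k (PolyRing k n m) :=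
  Algebra.adjoin k (Matrix.trace '' (GMN k n m : Set (MatPoly k n m)))

lemma CapS_TrS {n m : ℕ} (hn : 1 ≤ n) {t : PolyRing k n m} (ht : t ∈ TrS k n m) :
    ∀ z ∈ CapS k n m, t • z ∈ CapS k n m := by
  refine Algebra.adjoin_induction (p := fun t _ => ∀ z ∈ CapS k n m, t • z ∈ CapS k n m) ?_ ?_ ?_ ?_ ht
  · rintro _ ⟨x, hx, rfl⟩ z hz; exact CapS_trace k hn hx hz
  · intro r z hz; rw [algebraMap_smul]; exact Submodule.smul_mem _ r hz
  · intro x y _ _ hx hy z hz; rw [add_smul]; exact Submodule.add_mem _ (hx z hz) (hy z hz)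
  · intro x y _ _ hx hy z hz; rw [mul_smul]; exact hx _ (hy z hz)

lemma central_mem {n m : ℕ} (hn : 1 ≤ n) (w : Fin n × Fin n → MatPoly k n m)
    (hw : ∀ i, w i ∈ GMN k n m) (M : MatPoly k n m) (hM : M ∈ CapS k n m) :
    algebraMap (PolyRing k n m) (MatPoly k n m)
      (((Matrix.of fun i x => w i x.1 x.2).det ^ 2 * (swapMat (PolyRing k n m) n).det) * M.trace)
      ∈ GMN k n m := by
  rw [← gram_identity]
  apply CapS_le
  refine Submodule.sum_mem _ fun i _ => Submodule.sum_mem _ fun j _ => ?_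
  refine CapS_TrS k hn ?_ _ (CapS_mul_right k (hw j) (CapS_mul_left k (hw i) hM))
  let G : Matrix (Fin n × Fin n) (Fin n × Fin n) (TrS k n m) :=
    Matrix.of fun i j => ⟨(w i * w j).trace, Algebra.subset_adjoin
      ⟨_, Subalgebra.mul_mem _ (hw i) (hw j), rfl⟩⟩
  have := RingHom.map_adjugate ((TrS k n m).val : TrS k n m →+* PolyRing k n m) G
  have h2 : ((TrS k n m).val : TrS k n m →+* PolyRing k n m).mapMatrix G =
    Matrix.of fun i j => (w i * w j).trace := by ext i j; rfl
  rw [h2] at this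
  rw [← this]
  exact (G.adjugate i j).2

lemma eval_surj {n m : ℕ} {x : MTuple k n m} (hx : x ∈ genTuples k n m)
    (M : Matrix (Fin n) (Fin n) k) : ∃ p ∈ GMN k n m, evalMat k x p = M := by
  have h : (GMN k n m).map (evalMat k x) = ⊤ := by
    rw [GMN, AlgHom.map_adjoin, ← Set.range_comp]
    have : (evalMat k x) ∘ genericMatrix k n m = x := by
      funext h; exact gevM_generic k x h
    rw [this]; exact hx
  have : M ∈ (GMN k n m).map (evalMat k x) := by rw [h]; trivial
  exact this

lemma exists_central {n m : ℕ} (hn : 1 ≤ n) {x : MTuple k n m} (hx : x ∈ genTuples k n m) :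
    ∃ (s : PolyRing k n m) (M : MatPoly k n m),
      (∀ p ∈ GMN k n m, algebraMap (PolyRing k n m) (MatPoly k n m) (s * (M * p).trace) ∈ GMN k n m) ∧
      polyEval k x (s * M.trace) ≠ 0 := by
  choose U hU hUx using fun i : Fin n × Fin n => eval_surj k hx (Matrix.single i.1 i.2 1)
  let o : Fin n := ⟨0, hn⟩
  let p : Fin (n * n) → MatPoly k n m := fun i => U (o, (finProdFinEquiv.symm i).1)
  let q : Fin (n * n) → MatPoly k n m := fun i => U ((finProdFinEquiv.symm i).2, o)
  let u : Fin (n * n) → MatPoly k n m := fun i => U (finProdFinEquiv.symm i)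
  have hMem : cap (n * n) p q u ∈ CapS k n m :=
    Submodule.subset_span ⟨1, Subalgebra.one_mem _, 1, Subalgebra.one_mem _, p, q, u,
      fun _ => hU _, fun _ => hU _, fun _ => hU _, by simp⟩
  have hMx : evalMat k x (cap (n * n) p q u) = Matrix.single o o 1 := by
    have := map_cap (evalMat k x : MatPoly k n m →+* Matrix (Fin n) (Fin n) k) (n * n) p q u
    have h2 := cap_unit (R := k) hn o
    rw [← h2]
    refine this.trans ?_
    congr 1 <;> funext i <;> exact hUx _
  refine ⟨_, cap (n * n) p q u, fun r hr => central_mem k hn U hU _ (CapS_mul_right k hr hMem), ?_⟩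
  rw [map_mul, map_mul, map_pow]
  have hdet : polyEval k x (Matrix.of fun i (x : Fin n × Fin n) => U i x.1 x.2).det = 1 := by
    rw [AlgHom.map_det]
    have : (polyEval k x).mapMatrix (Matrix.of fun i (x : Fin n × Fin n) => U i x.1 x.2) = 1 := by
      ext ⟨a, b⟩ ⟨c, d⟩
      have := congrFun (congrFun (hUx (a, b)) c) d
      have h2 : (evalMat k x (U (a, b))) c d = polyEval k x (U (a, b) c d) := rfl
      rw [h2] at this
      simp only [AlgHom.mapMatrix_apply, Matrix.map_apply, Matrix.of_apply, this]
      simp [Matrix.single_apply, Matrix.one_apply]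
    rw [this, Matrix.det_one]
  have hsw : polyEval k x (swapMat (PolyRing k n m) n).det ≠ 0 := by
    intro h
    have h1 := congrArg (fun M => polyEval k x (Matrix.det M)) (swapMat_sq (PolyRing k n m) n)
    simp [h] at h1
  have htr : polyEval k x (cap (n * n) p q u).trace = 1 := by
    have : polyEval k x (cap (n * n) p q u).trace = (evalMat k x (cap (n * n) p q u)).trace := by
      simp [Matrix.trace, evalMat]
    rw [this, hMx]; simp
  rw [hdet, htr]; simpa using hsw
end PD
end

noncomputable section
section PE
set_option linter.unusedSectionVars false

/-- scalar matrix polynomial -/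
abbrev sc {n m : ℕ} (s : PolyRing k n m) : MatPoly k n m := algebraMap (PolyRing k n m) (MatPoly k n m) s

lemma eval_sc {n m : ℕ} {E : Type} [CommRing E] [Algebra k E] (y : Fin m → Matrix (Fin n) (Fin n) E)
    (s : PolyRing k n m) :
    gevM k y (sc k s) = algebraMap E (Matrix (Fin n) (Fin n) E) (gev k y s) := by
  ext i j
  simp only [gevM, AlgHom.mapMatrix_apply, Matrix.map_apply, Matrix.algebraMap_matrix_apply]
  split_ifs <;> simp

/-- scalar matrix polynomial as an element of `GMN` -/
def scE {n m : ℕ} (s : PolyRing k n m) (hs : sc k s ∈ GMN k n m) : GMN k n m := ⟨_, hs⟩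

lemma eval_scE {n m : ℕ} {E : Type} [CommRing E] [Algebra k E] (y : Fin m → Matrix (Fin n) (Fin n) E)
    (s : PolyRing k n m) (hs : sc k s ∈ GMN k n m) :
    gevM k y (scE k s hs) = algebraMap E (Matrix (Fin n) (Fin n) E) (gev k y s) := eval_sc k y s

lemma scE_comm {n m : ℕ} (s : PolyRing k n m) (hs : sc k s ∈ GMN k n m) (r : GMN k n m) :
    r * scE k s hs = scE k s hs * r := by
  ext1
  exact (Algebra.commutes s (r : MatPoly k n m)).symm

structure Model {n m : ℕ} (X : Set (MTuple k n m)) {A : Type} [Ring A] [Algebra k A]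
    (α : GMN k n m →ₐ[k] A) : Prop where
  ker : ∀ p, α p = 0 ↔ ∀ x ∈ X, evalMat k x p = 0
  unit : ∀ s (hs : sc k s ∈ GMN k n m), (∃ x ∈ X, polyEval k x s ≠ 0) → IsUnit (α (scE k s hs))
  frac : ∀ q : A, ∃ (r : GMN k n m) (s : PolyRing k n m) (hs : sc k s ∈ GMN k n m),
    (∃ x ∈ X, polyEval k x s ≠ 0) ∧ q * α (scE k s hs) = α r

lemma irr_mul {n m : ℕ} {X : Set (MTuple k n m)} (hX : IsIrredSubset k X) {s t : PolyRing k n m}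
    (hs : ∃ x ∈ X, polyEval k x s ≠ 0) (ht : ∃ x ∈ X, polyEval k x t ≠ 0) :
    ∃ x ∈ X, polyEval k x (s * t) ≠ 0 := by
  by_contra! h
  rcases hX.2 {a | ∀ p ∈ ({s} : Set (PolyRing k n m)), polyEval k a p = 0}
    {a | ∀ p ∈ ({t} : Set (PolyRing k n m)), polyEval k a p = 0} ⟨_, rfl⟩ ⟨_, rfl⟩ (by
      intro x hx
      have := h x hx
      rw [map_mul, mul_eq_zero] at this
      simpa using this) with h1 | h1
  · obtain ⟨x, hx, hh⟩ := hs
    exact hh (h1 hx s rfl)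
  · obtain ⟨x, hx, hh⟩ := ht
    exact hh (h1 hx t rfl)

lemma scalar_of_comm {n : ℕ} {R : Type} [CommRing R] (M : Matrix (Fin n) (Fin n) R)
    (h : ∀ N, M * N = N * M) : ∃ l : R, M = algebraMap R _ l := by
  have : M ∈ Set.center (Matrix (Fin n) (Fin n) R) := by
    rw [Semigroup.mem_center_iff]; intro g; exact (h g).symm
  rw [Matrix.center_eq_range] at this
  obtain ⟨l, hl⟩ := this
  exact ⟨l, by rw [← hl]; ext i j; simp [Matrix.scalar, Matrix.algebraMap_matrix_apply, Matrix.diagonal_apply]⟩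

def resGMN {n m : ℕ} (X : Set (MTuple k n m)) : GMN k n m →ₐ[k] coordRing k X :=
  ((restrictTo k X).comp (GMN k n m).val).codRestrict (coordRing k X)
    (fun p => ⟨p, p.2, rfl⟩)

lemma resGMN_apply {n m : ℕ} (X : Set (MTuple k n m)) (p : GMN k n m) (x : X) :
    (resGMN k X p : X → Matrix (Fin n) (Fin n) k) x = evalMat k x.1 p := rfl

lemma resGMN_surj {n m : ℕ} (X : Set (MTuple k n m)) : Function.Surjective (resGMN k X) := by
  rintro ⟨_, p, hp, rfl⟩
  exact ⟨⟨p, hp⟩, rfl⟩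

lemma resGMN_eq {n m : ℕ} (X : Set (MTuple k n m)) (p q : GMN k n m) :
    resGMN k X p = resGMN k X q ↔ ∀ x ∈ X, evalMat k x p = evalMat k x q := by
  rw [Subtype.ext_iff, funext_iff]
  exact ⟨fun h x hx => h ⟨x, hx⟩, fun h x => h x.1 x.2⟩

lemma sc_ne {n : ℕ} (hn : 1 ≤ n) {R : Type} [Field R] {l : R} (hl : l ≠ 0) :
    algebraMap R (Matrix (Fin n) (Fin n) R) l ≠ 0 := by
  have : Nonempty (Fin n) := ⟨⟨0, hn⟩⟩
  have : Nontrivial (Matrix (Fin n) (Fin n) R) := inferInstance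
  rwa [Ne, FaithfulSMul.algebraMap_eq_zero_iff]

lemma gev_trace {n m : ℕ} {E : Type} [CommRing E] [Algebra k E] (y : Fin m → Matrix (Fin n) (Fin n) E)
    (p : MatPoly k n m) : gev k y p.trace = (gevM k y p).trace := by
  simp [Matrix.trace, gevM]

lemma model_of_frac {n m : ℕ} (hn : 1 ≤ n) {X : Set (MTuple k n m)} (hX : X ⊆ genTuples k n m)
    {A : Type} [Ring A] [Algebra k A] (f : coordRing k X →ₐ[k] A) (hf : IsTotalFracHom k f) :
    Model k X (f.comp (resGMN k X)) := by
  obtain ⟨hinj, hunit, hfrac⟩ := hf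
  refine ⟨?_, ?_, ?_⟩
  · intro p
    rw [AlgHom.comp_apply, map_eq_zero_iff f hinj, ← map_zero (resGMN k X), resGMN_eq]
    simp
  · intro s hs ⟨x, hx, hxs⟩
    rw [AlgHom.comp_apply]
    refine hunit _ ?_ ?_
    · rw [Subring.mem_center_iff]
      intro g
      obtain ⟨g, rfl⟩ := resGMN_surj k X g
      rw [← map_mul, ← map_mul, scE_comm]
    · intro h
      rw [← map_zero (resGMN k X), resGMN_eq] at h
      have := h x hx
      rw [evalMat_eq_gevM] at this
      simp only [eval_scE] at this
      exact sc_ne hn hxs (by simpa [polyEval_eq_gev] using this)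
  · intro q
    obtain ⟨r, c, hc, hc0, hq⟩ := hfrac q
    obtain ⟨r, rfl⟩ := resGMN_surj k X r
    obtain ⟨p, rfl⟩ := resGMN_surj k X c
    have hsc : ∀ x ∈ X, ∃ l : k, evalMat k x p = algebraMap k _ l := by
      intro x hx
      apply scalar_of_comm
      intro N
      obtain ⟨r, hr, rfl⟩ := eval_surj k (hX hx) N
      rw [Subring.mem_center_iff] at hc
      have := hc (resGMN k X ⟨r, hr⟩)
      rw [← map_mul, ← map_mul, resGMN_eq] at this
      have := this x hx
      simpa using this.symm
    obtain ⟨x0, hx0, hp0⟩ : ∃ x ∈ X, evalMat k x p ≠ 0 := by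
      by_contra! h
      apply hc0
      rw [← map_zero (resGMN k X), resGMN_eq]
      simpa using h
    obtain ⟨s, M, hsM, hne⟩ := exists_central k hn (hX hx0)
    have h1 := hsM 1 (Subalgebra.one_mem _)
    rw [mul_one] at h1
    have hZ : ∀ x ∈ X, ∀ l : k, evalMat k x p = algebraMap k _ l →
        polyEval k x (s * (M * p).trace) = l * polyEval k x (s * M.trace) := by
      intro x hx l hl
      rw [map_mul, map_mul, polyEval_eq_gev, gev_trace, gev_trace, map_mul]
      rw [evalMat_eq_gevM] at hl
      rw [hl, ← Algebra.commutes, ← Algebra.smul_def, Matrix.trace_smul, smul_eq_mul]; ring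
    refine ⟨r * scE k _ h1, s * (M * p).trace, hsM p p.2, ⟨x0, hx0, ?_⟩, ?_⟩
    · obtain ⟨l, hl⟩ := hsc x0 hx0
      rw [hZ x0 hx0 l hl]
      refine mul_ne_zero ?_ hne
      rintro rfl
      rw [hl, map_zero] at hp0; exact hp0 rfl
    · have : (resGMN k X) (scE k _ (hsM p p.2)) = resGMN k X (p * scE k _ h1) := by
        rw [resGMN_eq]
        intro x hx
        obtain ⟨l, hl⟩ := hsc x hx
        have := hZ x hx l hl
        rw [polyEval_eq_gev] at this
        rw [MulMemClass.coe_mul, map_mul, hl]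
        simp only [evalMat_eq_gevM, eval_scE]
        rw [this, map_mul]
      rw [AlgHom.comp_apply, this, map_mul, map_mul, ← mul_assoc, hq, AlgHom.comp_apply, map_mul, map_mul]

variable {k}
namespace Model
variable {n m : ℕ} {X : Set (MTuple k n m)} {A : Type} [Ring A] [Algebra k A]
    {α : GMN k n m →ₐ[k] A}

lemma eq_iff (h : Model k X α) (p q : GMN k n m) : α p = α q ↔ ∀ x ∈ X, evalMat k x p = evalMat k x q := by
  rw [← sub_eq_zero, ← map_sub, h.ker]
  simp [sub_eq_zero]

lemma comm (h : Model k X α) (s) (hs : sc k s ∈ GMN k n m) (a : A) : a * α (scE k s hs) = α (scE k s hs) * a := by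
  have h0 : ∀ r, α r * α (scE k s hs) = α (scE k s hs) * α r := by
    intro r
    rw [← map_mul, ← map_mul, scE_comm]
  obtain ⟨r, t, ht, hx, hq⟩ := h.frac a
  have hu := h.unit t ht hx
  apply hu.mul_right_cancel
  rw [mul_assoc, ← h0, ← mul_assoc, hq, mul_assoc, hq, h0]

lemma fracs (h : Model k X α) (hX : IsIrredSubset k X) {l : ℕ} (q : Fin l → A) :
    ∃ (r : Fin l → GMN k n m) (s : PolyRing k n m) (hs : sc k s ∈ GMN k n m),
    (∃ x ∈ X, polyEval k x s ≠ 0) ∧ ∀ i, q i * α (scE k s hs) = α (r i) := by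
  induction l with
  | zero =>
    refine ⟨Fin.elim0, 1, by rw [sc, map_one]; exact Subalgebra.one_mem _, ?_, fun i => i.elim0⟩
    obtain ⟨x, hx⟩ := hX.1
    exact ⟨x, hx, by simp⟩
  | succ l ih =>
    obtain ⟨r, s, hs, hxs, hr⟩ := ih (fun i => q i.succ)
    obtain ⟨r0, t, ht, hxt, hr0⟩ := h.frac (q 0)
    have hmem : sc k (s * t) ∈ GMN k n m := by
      rw [sc, map_mul]; exact Subalgebra.mul_mem _ hs ht
    have he : scE k _ hmem = scE k _ hs * scE k _ ht := by ext1; exact map_mul _ _ _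
    refine ⟨Fin.cons (r0 * scE k _ hs) (fun i => r i * scE k _ ht), s * t, hmem, irr_mul k hX hxs hxt, ?_⟩
    intro i
    refine Fin.cases ?_ (fun i => ?_) i
    · rw [he, Fin.cons_zero, map_mul, map_mul, h.comm t ht, ← mul_assoc, hr0]
    · rw [he, Fin.cons_succ, map_mul, map_mul, ← mul_assoc, hr]
end Model
end PE
end

noncomputable section
section PF
set_option linter.unusedSectionVars false
open scoped TensorProduct

lemma span_of_det {n : ℕ} {E : Type} [Field E] (w : Fin n × Fin n → Matrix (Fin n) (Fin n) E)
    (h : (Matrix.of fun i (x : Fin n × Fin n) => w i x.1 x.2).det ≠ 0) :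
    Submodule.span E (Set.range w) = ⊤ := by
  set W := (Matrix.of fun i (x : Fin n × Fin n) => w i x.1 x.2) with hW
  rw [eq_top_iff]
  intro M _
  have hu : IsUnit W.det := h.isUnit
  let c : Fin n × Fin n → E := Matrix.vecMul (fun x => M x.1 x.2) W⁻¹
  have hc : Matrix.vecMul c W = fun x => M x.1 x.2 := by
    simp only [c, Matrix.vecMul_vecMul, Matrix.nonsing_inv_mul _ hu, Matrix.vecMul_one]
  have : M = ∑ i, c i • w i := by
    ext a b
    have h2 := congrFun hc (a, b)
    simp only [Matrix.vecMul, dotProduct] at h2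
    rw [← h2, Matrix.sum_apply]
    rfl
  rw [this]
  exact Submodule.sum_mem _ fun i _ => Submodule.smul_mem _ _ (Submodule.subset_span ⟨i, rfl⟩)

/-- generic point of an irreducible set -/
lemma exists_generic {n m : ℕ} {X : Set (MTuple k n m)} (hX : IsIrredSubset k X) :
    ∃ (E : Type) (_ : Field E) (_ : Algebra k E) (ξ : Fin m → Matrix (Fin n) (Fin n) E),
      ∀ q, gev k ξ q = 0 ↔ ∀ x ∈ X, polyEval k x q = 0 := by
  let I : Ideal (PolyRing k n m) :=
    { carrier := {q | ∀ x ∈ X, polyEval k x q = 0}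
      add_mem' := fun {a b} ha hb x hx => by rw [map_add, ha x hx, hb x hx, add_zero]
      zero_mem' := fun x hx => map_zero _
      smul_mem' := fun c a ha x hx => by rw [smul_eq_mul, map_mul, ha x hx, mul_zero] }
  have hI : ∀ q, q ∈ I ↔ ∀ x ∈ X, polyEval k x q = 0 := fun q => Iff.rfl
  have hP : I.IsPrime := by
    refine ⟨?_, ?_⟩
    · rw [Ideal.ne_top_iff_one]
      obtain ⟨x, hx⟩ := hX.1
      intro h; have := h x hx; simp at this
    · intro p q h
      by_contra! hh
      simp only [hI, not_forall] at hh
      obtain ⟨⟨x, hx, h1⟩, ⟨y, hy, h2⟩⟩ := hh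
      obtain ⟨z, hz, h3⟩ := irr_mul k hX ⟨x, hx, h1⟩ ⟨y, hy, h2⟩
      exact h3 (h z hz)
  let φ : PolyRing k n m →ₐ[k] FractionRing (PolyRing k n m ⧸ I) :=
    (IsScalarTower.toAlgHom k (PolyRing k n m ⧸ I) (FractionRing (PolyRing k n m ⧸ I))).comp
      (Ideal.Quotient.mkₐ k I)
  refine ⟨FractionRing (PolyRing k n m ⧸ I), inferInstance, inferInstance,
    fun h => Matrix.of fun i j => φ (MvPolynomial.X (h, i, j)), fun q => ?_⟩
  have : gev k (fun h => Matrix.of fun i j => φ (MvPolynomial.X (h, i, j))) = φ := by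
    ext x; simp [gev]
  rw [this, ← hI, ← Ideal.Quotient.eq_zero_iff_mem]
  exact map_eq_zero_iff (algebraMap (PolyRing k n m ⧸ I) (FractionRing (PolyRing k n m ⧸ I)))
    (IsFractionRing.injective _ _)

section gen
variable {k} {n m : ℕ} {X : Set (MTuple k n m)} {E : Type} [Field E] [Algebra k E]
  {ξ : Fin m → Matrix (Fin n) (Fin n) E}

lemma gen_mat (hξ : ∀ q, gev k ξ q = 0 ↔ ∀ x ∈ X, polyEval k x q = 0) (p : MatPoly k n m) :
    gevM k ξ p = 0 ↔ ∀ x ∈ X, evalMat k x p = 0 := by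
  constructor
  · intro h x hx
    ext i j
    exact (hξ (p i j)).mp (congrFun (congrFun h i) j) x hx
  · intro h
    ext i j
    exact (hξ (p i j)).mpr fun x hx => congrFun (congrFun (h x hx) i) j

lemma gen_mat_eq (hξ : ∀ q, gev k ξ q = 0 ↔ ∀ x ∈ X, polyEval k x q = 0) (p q : MatPoly k n m) :
    gevM k ξ p = gevM k ξ q ↔ ∀ x ∈ X, evalMat k x p = evalMat k x q := by
  rw [← sub_eq_zero, ← map_sub, gen_mat hξ]
  simp [sub_eq_zero]

lemma gen_ne (hξ : ∀ q, gev k ξ q = 0 ↔ ∀ x ∈ X, polyEval k x q = 0) {s : PolyRing k n m}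
    (hs : ∃ x ∈ X, polyEval k x s ≠ 0) : gev k ξ s ≠ 0 := by
  rw [Ne, hξ]; push Not; exact hs

lemma gen_span (hξ : ∀ q, gev k ξ q = 0 ↔ ∀ x ∈ X, polyEval k x q = 0) (hne : X.Nonempty)
    (hX : X ⊆ genTuples k n m) :
    Submodule.span E (gevM k ξ '' (GMN k n m : Set (MatPoly k n m))) = ⊤ := by
  obtain ⟨x, hx⟩ := hne
  choose U hU hUx using fun i : Fin n × Fin n => eval_surj k (hX hx) (Matrix.single i.1 i.2 1)
  have hdet : polyEval k x (Matrix.of fun i (x : Fin n × Fin n) => U i x.1 x.2).det ≠ 0 := by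
    rw [AlgHom.map_det]
    have : (polyEval k x).mapMatrix (Matrix.of fun i (x : Fin n × Fin n) => U i x.1 x.2) = 1 := by
      ext ⟨a, b⟩ ⟨c, d⟩
      have := congrFun (congrFun (hUx (a, b)) c) d
      have h2 : (evalMat k x (U (a, b))) c d = polyEval k x (U (a, b) c d) := rfl
      rw [h2] at this
      simp only [AlgHom.mapMatrix_apply, Matrix.map_apply, Matrix.of_apply, this]
      simp [Matrix.single_apply, Matrix.one_apply]
    rw [this, Matrix.det_one]; exact one_ne_zero
  have h2 := gen_ne hξ ⟨x, hx, hdet⟩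
  rw [AlgHom.map_det] at h2
  have h3 := span_of_det (fun i => gevM k ξ (U i)) h2
  rw [eq_top_iff, ← h3]
  apply Submodule.span_mono
  rintro _ ⟨i, rfl⟩
  exact ⟨_, hU i, rfl⟩

lemma exists_beta {A : Type} [Ring A] [Algebra k A] {α : GMN k n m →ₐ[k] A} (h : Model k X α)
    (hirr : IsIrredSubset k X)
    (hξ : ∀ q, gev k ξ q = 0 ↔ ∀ x ∈ X, polyEval k x q = 0) :
    ∃ β : A →ₐ[k] Matrix (Fin n) (Fin n) E, ∀ p : GMN k n m, β (α p) = gevM k ξ p := by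
  choose r s hs hxs hr using h.frac
  let β : A → Matrix (Fin n) (Fin n) E := fun q => (gev k ξ (s q))⁻¹ • gevM k ξ (r q)
  have h1 : ∀ q, gev k ξ (s q) • β q = gevM k ξ (r q) := fun q => by
    simp only [β]; rw [smul_smul, mul_inv_cancel₀ (gen_ne hξ (hxs q)), one_smul]
  have key : ∀ q (r' : GMN k n m) s' (hs' : sc k s' ∈ GMN k n m), q * α (scE k s' hs') = α r' →
      gev k ξ s' • β q = gevM k ξ r' := by
    intro q r' s' hs' hq
    have e1 : α (r q * scE k _ hs') = α (r' * scE k _ (hs q)) := by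
      rw [map_mul, map_mul, ← hr, ← hq, mul_assoc, mul_assoc, h.comm s' hs']
    rw [h.eq_iff, ← gen_mat_eq hξ] at e1
    simp only [MulMemClass.coe_mul, map_mul, eval_scE] at e1
    rw [← Algebra.commutes, ← Algebra.commutes, ← Algebra.smul_def, ← Algebra.smul_def] at e1
    simp only [β]
    rw [smul_comm, e1, smul_smul, inv_mul_cancel₀ (gen_ne hξ (hxs q)), one_smul]
  clear_value β
  have hsmul : ∀ q q', sc k (s q * s q') ∈ GMN k n m := fun q q' => by
    rw [sc, map_mul]; exact Subalgebra.mul_mem _ (hs q) (hs q')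
  have he : ∀ q q', scE k _ (hsmul q q') = scE k _ (hs q) * scE k _ (hs q') := fun q q' => by
    ext1; exact map_mul _ _ _
  have hone : sc k 1 ∈ GMN k n m := by rw [sc, map_one]; exact Subalgebra.one_mem _
  have heone : scE k 1 hone = 1 := by ext1; exact map_one _
  have hρ : ∀ p : GMN k n m, β (α p) = gevM k ξ p := by
    intro p
    have := key (α p) p 1 hone (by rw [heone, map_one, mul_one])
    rwa [map_one, one_smul] at this
  have hnz : ∀ q q', gev k ξ (s q * s q') ≠ 0 := fun q q' => by
    rw [map_mul]; exact mul_ne_zero (gen_ne hξ (hxs q)) (gen_ne hξ (hxs q'))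
  refine ⟨{ toFun := β, map_one' := ?_, map_mul' := ?_, map_zero' := ?_, map_add' := ?_,
            commutes' := ?_}, hρ⟩
  · have := hρ 1; rwa [map_one, OneMemClass.coe_one, map_one] at this
  · intro q q'
    have := key (q * q') (r q * r q') _ (hsmul q q') (by
      rw [he, map_mul, map_mul, ← hr, ← hr, mul_assoc, mul_assoc]
      rw [← mul_assoc q' , h.comm _ (hs q) q', mul_assoc])
    rw [MulMemClass.coe_mul, map_mul (gevM k ξ), ← h1, ← h1, smul_mul_smul_comm, ← map_mul] at this
    exact smul_right_injective _ (hnz q q') this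
  · have := hρ 0; rwa [map_zero, ZeroMemClass.coe_zero, map_zero] at this
  · intro q q'
    have := key (q + q') (r q * scE k _ (hs q') + r q' * scE k _ (hs q)) _ (hsmul q q') (by
      rw [he, map_mul, map_add, map_mul, map_mul, ← hr, ← hr, add_mul, mul_assoc, mul_assoc,
        h.comm _ (hs q) (α (scE k _ (hs q')))])
    refine smul_right_injective _ (hnz q q') (this.trans ?_)
    simp only [AddMemClass.coe_add, MulMemClass.coe_mul, map_add, map_mul, eval_scE, ← h1]
    rw [← Algebra.commutes, ← Algebra.commutes, ← Algebra.smul_def, ← Algebra.smul_def, smul_smul,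
      smul_smul, smul_add, mul_comm (gev k ξ (s q'))]
  · intro c
    have := hρ (algebraMap k _ c)
    rw [AlgHom.commutes] at this
    rw [← (gevM k ξ).commutes]
    exact this
end gen

lemma beta_scalar {n : ℕ} (hn : 1 ≤ n) {K A E : Type} [Field K] [Field E] [Algebra k K] [Algebra k E] [Ring A]
    [Algebra K A] [Algebra k A] [IsScalarTower k K A]
    (β : A →ₐ[k] Matrix (Fin n) (Fin n) E) (hβ : Submodule.span E (Set.range β) = ⊤) :
    ∃ σ : K →ₐ[k] E, ∀ c, β (algebraMap K A c) = algebraMap E _ (σ c) := by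
  have h : ∀ c, ∃ l : E, β (algebraMap K A c) = algebraMap E _ l := by
    intro c
    apply scalar_of_comm
    intro N
    have hN : N ∈ Submodule.span E (Set.range β) := by rw [hβ]; trivial
    induction hN using Submodule.span_induction with
    | mem x hx =>
      obtain ⟨a, rfl⟩ := hx
      rw [← map_mul, ← map_mul, Algebra.commutes]
    | zero => simp
    | add x y _ _ hx hy => rw [mul_add, add_mul, hx, hy]
    | smul a x _ hx => rw [mul_smul_comm, smul_mul_assoc, hx]
  choose σ hσ using h
  have : Nonempty (Fin n) := ⟨⟨0, hn⟩⟩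
  have hinj : Function.Injective (algebraMap E (Matrix (Fin n) (Fin n) E)) :=
    FaithfulSMul.algebraMap_injective _ _
  refine ⟨{ toFun := σ, map_one' := ?_, map_mul' := ?_, map_zero' := ?_, map_add' := ?_,
            commutes' := ?_}, hσ⟩
  · apply hinj; rw [← hσ]; simp
  · intro x y; apply hinj; rw [← hσ]; simp [hσ]
  · apply hinj; rw [← hσ]; simp
  · intro x y; apply hinj; rw [← hσ]; simp [hσ]
  · intro c; apply hinj; rw [← hσ, ← IsScalarTower.algebraMap_apply k K A, AlgHom.commutes]
    exact IsScalarTower.algebraMap_apply k E _ _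

lemma exists_conj {n : ℕ} (hn : 1 ≤ n) {K A Ω : Type} [Field K] [Field Ω] [Ring A] [Algebra K A]
    [Algebra K Ω] (hdeg : Module.finrank K A = n ^ 2)
    (γ γ' : A →ₐ[K] Matrix (Fin n) (Fin n) Ω) (h : Submodule.span Ω (Set.range γ) = ⊤)
    (h' : Submodule.span Ω (Set.range γ') = ⊤) :
    ∃ g : Matrix (Fin n) (Fin n) Ω, g.det ≠ 0 ∧ ∀ a, γ' a = g * γ a * g⁻¹ := by
  have : Module.Finite K A := Module.finite_of_finrank_pos (by rw [hdeg]; positivity)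
  have key : ∀ γ : A →ₐ[K] Matrix (Fin n) (Fin n) Ω, Submodule.span Ω (Set.range γ) = ⊤ →
      ∃ e : (Ω ⊗[K] A) ≃ₐ[Ω] Matrix (Fin n) (Fin n) Ω, ∀ a, e (1 ⊗ₜ a) = γ a := by
    intro γ h
    let f : (Ω ⊗[K] A) →ₐ[Ω] Matrix (Fin n) (Fin n) Ω :=
      Algebra.TensorProduct.lift (Algebra.ofId _ _) γ (fun x y => Algebra.commutes _ _)
    have hf : ∀ a, f (1 ⊗ₜ a) = γ a := fun a => (Algebra.TensorProduct.lift_tmul _ _ _ _ _).trans (by simp)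
    have hsurj : Function.Surjective f := by
      have : LinearMap.range f.toLinearMap = ⊤ := by
        rw [eq_top_iff, ← h, Submodule.span_le]
        rintro _ ⟨a, rfl⟩
        exact ⟨1 ⊗ₜ a, hf a⟩
      exact LinearMap.range_eq_top.mp this
    have hrank : Module.finrank Ω (Ω ⊗[K] A) = Module.finrank Ω (Matrix (Fin n) (Fin n) Ω) := by
      rw [Module.finrank_baseChange, hdeg, Module.finrank_matrix]; simp; ring
    have hinj : Function.Injective f :=
      (LinearMap.injective_iff_surjective_of_finrank_eq_finrank (f := f.toLinearMap) hrank).mpr hsurj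
    exact ⟨AlgEquiv.ofBijective f ⟨hinj, hsurj⟩, hf⟩
  obtain ⟨e, he⟩ := key γ h
  obtain ⟨e', he'⟩ := key γ' h'
  let φ : Module.End Ω (Fin n → Ω) ≃ₐ[Ω] Module.End Ω (Fin n → Ω) :=
    (Matrix.toLinAlgEquiv' (R := Ω) (n := Fin n)).symm.trans ((e.symm.trans e').trans Matrix.toLinAlgEquiv')
  obtain ⟨T, hT⟩ := AlgEquiv.eq_linearEquivConjAlgEquiv φ
  let g := LinearMap.toMatrix' (T : (Fin n → Ω) →ₗ[Ω] (Fin n → Ω))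
  let g' := LinearMap.toMatrix' (T.symm : (Fin n → Ω) →ₗ[Ω] (Fin n → Ω))
  have hgg : g * g' = 1 := by
    simp only [g, g']; rw [← LinearMap.toMatrix'_comp]; simp
  have hinv : g⁻¹ = g' := Matrix.inv_eq_right_inv hgg
  refine ⟨g, ?_, fun a => ?_⟩
  · intro h0
    have := congrArg Matrix.det hgg
    rw [Matrix.det_mul, h0, zero_mul, Matrix.det_one] at this
    exact zero_ne_one this
  · have h1 : φ (Matrix.toLin' (γ a)) = Matrix.toLin' (γ' a) := by
      have : e.symm (γ a) = 1 ⊗ₜ a := by rw [← he, AlgEquiv.symm_apply_apply]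
      rw [← he' a, ← this]
      have h2 : (Matrix.toLinAlgEquiv' (R := Ω) (n := Fin n)).symm (Matrix.toLin' (γ a)) = γ a :=
        LinearMap.toMatrix'_toLin' _
      simp only [φ, AlgEquiv.trans_apply, h2]
      rfl
    rw [hT] at h1
    rw [hinv]
    have h3 := congrArg LinearMap.toMatrix' h1
    rw [LinearMap.toMatrix'_toLin'] at h3
    rw [← h3, LinearEquiv.conjAlgEquiv_apply, LinearMap.toMatrix'_comp, LinearMap.toMatrix'_comp,
      LinearMap.toMatrix'_toLin', Matrix.mul_assoc]
end PF
end

noncomputable section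
section PG
set_option linter.unusedSectionVars false
open scoped TensorProduct

lemma exists_common {K E1 E2 : Type} [Field K] [Field E1] [Field E2] [Algebra K E1] [Algebra K E2] :
    ∃ (Ω : Type) (_ : Field Ω) (_ : Algebra K Ω), Nonempty (E1 →ₐ[K] Ω) ∧ Nonempty (E2 →ₐ[K] Ω) := by
  obtain ⟨I, hI⟩ := Ideal.exists_maximal (E1 ⊗[K] E2)
  letI := Ideal.Quotient.field I
  exact ⟨(E1 ⊗[K] E2) ⧸ I, inferInstance, inferInstance,
    ⟨(Ideal.Quotient.mkₐ K I).comp Algebra.TensorProduct.includeLeft⟩,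
    ⟨(Ideal.Quotient.mkₐ K I).comp Algebra.TensorProduct.includeRight⟩⟩

lemma span_map {n : ℕ} {E Ω : Type} [Field E] [Field Ω] (φ : E →+* Ω)
    (S : Set (Matrix (Fin n) (Fin n) E)) (h : Submodule.span E S = ⊤) :
    Submodule.span Ω (φ.mapMatrix '' S) = ⊤ := by
  have h1 : ∀ N : Matrix (Fin n) (Fin n) E, φ.mapMatrix N ∈ Submodule.span Ω (φ.mapMatrix '' S) := by
    intro N
    have hN : N ∈ Submodule.span E S := by rw [h]; trivial
    induction hN using Submodule.span_induction with
    | mem x hx => exact Submodule.subset_span ⟨x, hx, rfl⟩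
    | zero => rw [map_zero]; exact Submodule.zero_mem _
    | add x y _ _ hx hy => rw [map_add]; exact Submodule.add_mem _ hx hy
    | smul a x _ hx =>
      have : φ.mapMatrix (a • x) = φ a • φ.mapMatrix x := by ext i j; simp
      rw [this]; exact Submodule.smul_mem _ _ hx
  rw [eq_top_iff]
  intro M _
  rw [Matrix.matrix_eq_sum_single M]
  refine Submodule.sum_mem _ fun i _ => Submodule.sum_mem _ fun j _ => ?_
  have : Matrix.single i j (M i j) = M i j • φ.mapMatrix (Matrix.single i j 1) := by
    simp [Matrix.map_single]
  rw [this]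
  exact Submodule.smul_mem _ _ (h1 _)

lemma conj_vanish {n m : ℕ} {X : Set (MTuple k n m)}
    (hinv : ∀ g : GL (Fin n) k, ∀ a ∈ X, conjAct k g a ∈ X)
    {E : Type} [Field E] [Algebra k E] {ξ : Fin m → Matrix (Fin n) (Fin n) E}
    (hξ : ∀ q, gev k ξ q = 0 ↔ ∀ x ∈ X, polyEval k x q = 0)
    (q : PolyRing k n m) (hq : ∀ x ∈ X, polyEval k x q = 0) (g : GL (Fin n) k) :
    gev k (fun i => gmap k E g * ξ i * (gmap k E g)⁻¹) q = 0 := by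
  let G : Fin m → MatPoly k n m := fun i =>
    (g : Matrix (Fin n) (Fin n) k).map (algebraMap k (PolyRing k n m)) * genericMatrix k n m i *
      ((g⁻¹ : GL (Fin n) k) : Matrix (Fin n) (Fin n) k).map (algebraMap k (PolyRing k n m))
  have key : ∀ (F : Type) [Field F] [Algebra k F] (y : Fin m → Matrix (Fin n) (Fin n) F),
      gev k y (gev k G q) = gev k (fun i => gmap k F g * y i * gmap k F g⁻¹) q := by
    intro F _ _ y
    rw [gev_comp]
    congr 1
    congr 1
    funext i
    have h1 : ∀ M : Matrix (Fin n) (Fin n) k, (gevM k y) (M.map (algebraMap k (PolyRing k n m))) =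
        M.map (algebraMap k F) := by
      intro M; ext a b; simp [gevM]
    have : (gevM k y) (G i) = gmap k F g * y i * gmap k F g⁻¹ := by
      simp only [G, map_mul, gevM_generic, h1, gmap]
    exact this
  have hginv : ∀ (F : Type) [Field F] [Algebra k F], (gmap k F g)⁻¹ = gmap k F g⁻¹ := by
    intro F _ _
    apply Matrix.inv_eq_right_inv
    rw [gmap, gmap, ← Matrix.map_mul, ← Units.val_mul, mul_inv_cancel]
    simp
  rw [hginv, ← key, hξ]
  intro x hx
  rw [polyEval_eq_gev, key]
  have := hq _ (hinv g x hx)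
  rw [polyEval_eq_gev] at this
  rw [← this]
  congr 1

lemma closed_half {n m m' : ℕ} (hn : 1 ≤ n) {X : Set (MTuple k n m)} {X' : Set (MTuple k n m')}
    (hX : X ⊆ genTuples k n m) (hXi : IsIrredSubset k X)
    (hX' : X' ⊆ genTuples k n m') (hXi' : IsIrredSubset k X')
    (hinv : ∀ g : GL (Fin n) k, ∀ a ∈ X', conjAct k g a ∈ X')
    {K : Type} [Field K] [Algebra k K] {A : Type} [Ring A] [Algebra K A] [Algebra k A]
    [IsScalarTower k K A] (hdeg : Module.finrank K A = n ^ 2)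
    {α : GMN k n m →ₐ[k] A} (hα : Model k X α) {α' : GMN k n m' →ₐ[k] A} (hα' : Model k X' α')
    (Y : Fin m' → GMN k n m') (hY : ∀ i, (Y i : MatPoly k n m') = genericMatrix k n m' i)
    (P : Fin m' → GMN k n m) (s : PolyRing k n m) (hs : sc k s ∈ GMN k n m)
    (hsX : ∃ x ∈ X, polyEval k x s ≠ 0)
    (hP : ∀ i, α' (Y i) * α (scE k s hs) = α (P i))
    (q : PolyRing k n m') (hq : ∀ x ∈ X', polyEval k x q = 0) (x : MTuple k n m) (hx : x ∈ X)
    (hxs : polyEval k x s ≠ 0) :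
    polyEval k (fun i => (polyEval k x s)⁻¹ • evalMat k x (P i)) q = 0 := by
  obtain ⟨E, _, _, ξ, hξ⟩ := exists_generic k hXi
  obtain ⟨E', _, _, ξ', hξ'⟩ := exists_generic k hXi'
  obtain ⟨β, hβ⟩ := exists_beta hα hXi hξ
  obtain ⟨β', hβ'⟩ := exists_beta hα' hXi' hξ'
  have hsp : Submodule.span E (Set.range β) = ⊤ := by
    rw [eq_top_iff, ← gen_span hξ hXi.1 hX]
    apply Submodule.span_mono
    rintro _ ⟨p, hp, rfl⟩
    exact ⟨_, hβ ⟨p, hp⟩⟩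
  have hsp' : Submodule.span E' (Set.range β') = ⊤ := by
    rw [eq_top_iff, ← gen_span hξ' hXi'.1 hX']
    apply Submodule.span_mono
    rintro _ ⟨p, hp, rfl⟩
    exact ⟨_, hβ' ⟨p, hp⟩⟩
  obtain ⟨σ, hσ⟩ := beta_scalar k (K := K) hn β hsp
  obtain ⟨σ', hσ'⟩ := beta_scalar k (K := K) hn β' hsp'
  letI : Algebra K E := σ.toRingHom.toAlgebra
  letI : Algebra K E' := σ'.toRingHom.toAlgebra
  obtain ⟨Ω, _, _, ⟨i⟩, ⟨i'⟩⟩ := exists_common (K := K) (E1 := E) (E2 := E')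
  letI : Algebra k Ω := ((algebraMap K Ω).comp (algebraMap k K)).toAlgebra
  have hi : ∀ c, i (σ c) = algebraMap K Ω c := i.commutes
  have hi' : ∀ c, i' (σ' c) = algebraMap K Ω c := i'.commutes
  let ik : E →ₐ[k] Ω := { i.toRingHom with
    commutes' := fun c => by
      have := hi (algebraMap k K c)
      rw [AlgHom.commutes] at this
      exact this }
  let ik' : E' →ₐ[k] Ω := { i'.toRingHom with
    commutes' := fun c => by
      have := hi' (algebraMap k K c)
      rw [AlgHom.commutes] at this
      exact this }
  let γ : A →ₐ[K] Matrix (Fin n) (Fin n) Ω := { (i.toRingHom.mapMatrix).comp β.toRingHom with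
    commutes' := fun c => by
      have : i.toRingHom.mapMatrix (β (algebraMap K A c)) = algebraMap K _ c := by
        rw [hσ]
        ext a b
        simp only [RingHom.mapMatrix_apply, Matrix.map_apply, Matrix.algebraMap_matrix_apply]
        split_ifs
        · exact hi c
        · exact map_zero i
      exact this }
  let γ' : A →ₐ[K] Matrix (Fin n) (Fin n) Ω := { (i'.toRingHom.mapMatrix).comp β'.toRingHom with
    commutes' := fun c => by
      have : i'.toRingHom.mapMatrix (β' (algebraMap K A c)) = algebraMap K _ c := by
        rw [hσ']
        ext a b
        simp only [RingHom.mapMatrix_apply, Matrix.map_apply, Matrix.algebraMap_matrix_apply]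
        split_ifs
        · exact hi' c
        · exact map_zero i'
      exact this }
  have hγ : Submodule.span Ω (Set.range γ) = ⊤ := by
    rw [← span_map i.toRingHom _ hsp, ← Set.range_comp]; rfl
  have hγ' : Submodule.span Ω (Set.range γ') = ⊤ := by
    rw [← span_map i'.toRingHom _ hsp', ← Set.range_comp]; rfl
  obtain ⟨g, hg, hgγ⟩ := exists_conj hn hdeg γ' γ hγ' hγ
  -- the point `η`
  let η : Fin m' → Matrix (Fin n) (Fin n) E := fun j => β (α' (Y j))
  have h1 : gev k (fun j => g * (ξ' j).map ik' * g⁻¹) q = 0 := by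
    refine conj_density k _ q (fun g0 => ?_) g hg
    have h2 := conj_vanish k hinv hξ' q hq g0
    have h3 := congrArg ik' h2
    rw [gev_comp, map_zero] at h3
    rw [← h3]
    congr 1
    congr 1
    funext j
    have hgm : ∀ g0 : GL (Fin n) k, (gmap k E' g0).map ik' = gmap k Ω g0 := by
      intro g0; ext a b; simp [gmap]
    have hginv : ∀ (F : Type) [Field F] [Algebra k F], (gmap k F g0)⁻¹ = gmap k F g0⁻¹ := by
      intro F _ _
      apply Matrix.inv_eq_right_inv
      rw [gmap, gmap, ← Matrix.map_mul, ← Units.val_mul, mul_inv_cancel]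
      simp
    rw [hginv, hginv, Matrix.map_mul, Matrix.map_mul, hgm, hgm]
  have h2 : ik (gev k η q) = 0 := by
    rw [gev_comp, ← h1]
    congr 1
    congr 1
    funext j
    have e1 : (η j).map ik = γ (α' (Y j)) := rfl
    have e2 : γ' (α' (Y j)) = (ξ' j).map ik' := by
      have : γ' (α' (Y j)) = (β' (α' (Y j))).map ik' := rfl
      rw [this, hβ', hY, gevM_generic]
    rw [e1, hgγ, e2]
  have h3 : gev k η q = 0 := by
    have : Function.Injective ik := (ik : E →+* Ω).injective
    exact (map_eq_zero_iff ik this).mp h2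
  have hη : ∀ j, η j = (gev k ξ s)⁻¹ • gevM k ξ (P j) := by
    intro j
    have e1 := congrArg β (hP j)
    rw [map_mul, hβ, hβ, eval_scE, ← Algebra.commutes, ← Algebra.smul_def] at e1
    rw [← e1, smul_smul, inv_mul_cancel₀ (gen_ne hξ hsX), one_smul]
  obtain ⟨N, t, ht⟩ := homogenize k (fun j => (P j : MatPoly k n m)) s q
  have h4 : gev k ξ t = 0 := by
    rw [ht E (gev k ξ) (gen_ne hξ hsX)]
    have : (fun j => (gev k ξ s)⁻¹ • (P j : MatPoly k n m).map (gev k ξ)) = η := by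
      funext j; rw [hη]; rfl
    rw [this, h3, mul_zero]
  have h5 := (hξ t).mp h4 x hx
  rw [ht k (polyEval k x) hxs] at h5
  exact (mul_eq_zero.mp h5).resolve_left (pow_ne_zero _ hxs)
end PG
end

noncomputable section
section PH
set_option linter.unusedSectionVars false

/-- value of the rational map with denominators `s` -/
def rv {n m l : ℕ} (P : Fin l → GMN k n m) (s : PolyRing k n m) (x : MTuple k n m) : MTuple k n l :=
  fun i => (polyEval k x s)⁻¹ • evalMat k x (P i)

lemma eval_scE' {n m : ℕ} (x : MTuple k n m) (s : PolyRing k n m) (hs : sc k s ∈ GMN k n m) :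
    evalMat k x (scE k s hs) = algebraMap k _ (polyEval k x s) := eval_sc k x s

lemma nch {n m m' : ℕ} {A : Type} [Ring A] [Algebra k A]
    {X : Set (MTuple k n m)}
    {α : GMN k n m →ₐ[k] A} (hα : Model k X α) {α' : GMN k n m' →ₐ[k] A}
    (Y : Fin m' → GMN k n m') (hY : ∀ i, (Y i : MatPoly k n m') = genericMatrix k n m' i)
    (P : Fin m' → GMN k n m) (s : PolyRing k n m) (hs : sc k s ∈ GMN k n m)
    (hP : ∀ i, α' (Y i) * α (scE k s hs) = α (P i))
    (g : MatPoly k n m') (hg : g ∈ GMN k n m') : ∃ (N : ℕ) (g' : GMN k n m),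
    α g' = α' ⟨g, hg⟩ * α (scE k s hs) ^ N ∧
    ∀ x, polyEval k x s ≠ 0 → evalMat k x g' = polyEval k x s ^ N • evalMat k (rv k P s x) g := by
  refine Algebra.adjoin_induction (p := fun g hg => ∃ (N : ℕ) (g' : GMN k n m),
    α g' = α' ⟨g, hg⟩ * α (scE k s hs) ^ N ∧
    ∀ x, polyEval k x s ≠ 0 → evalMat k x g' = polyEval k x s ^ N • evalMat k (rv k P s x) g)
    ?_ ?_ ?_ ?_ hg
  · rintro _ ⟨i, rfl⟩
    refine ⟨1, P i, ?_, fun x hx => ?_⟩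
    · rw [pow_one, ← hP]; congr 2; ext1; exact hY i
    · rw [pow_one, evalMat_eq_gevM k (rv k P s x), gevM_generic, rv, smul_smul, mul_inv_cancel₀ hx, one_smul]
  · intro c
    refine ⟨0, algebraMap k _ c, ?_, fun x hx => ?_⟩
    · rw [pow_zero, mul_one, AlgHom.commutes]
      exact (α'.commutes c).symm
    · rw [pow_zero, one_smul, AlgHom.commutes]
      exact (evalMat k x).commutes c
  · rintro a b ha hb ⟨N, a', h1, h2⟩ ⟨N', b', h1', h2'⟩
    refine ⟨N + N', a' * scE k s hs ^ N' + b' * scE k s hs ^ N, ?_, fun x hx => ?_⟩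
    · have : (⟨a + b, Subalgebra.add_mem _ ha hb⟩ : GMN k n m') = ⟨a, ha⟩ + ⟨b, hb⟩ := rfl
      rw [this]
      simp only [map_add, map_mul, map_pow, h1, h1', mul_assoc, add_mul, ← pow_add]
      rw [add_comm N' N]
    · have e : ∀ M : ℕ, evalMat k x ((scE k s hs ^ M : GMN k n m) : MatPoly k n m) =
          algebraMap k _ (polyEval k x s ^ M) := by
        intro M; rw [SubmonoidClass.coe_pow, map_pow, eval_scE', map_pow]
      rw [AddMemClass.coe_add, MulMemClass.coe_mul, MulMemClass.coe_mul, map_add, map_mul, map_mul,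
        e, e, ← Algebra.commutes, ← Algebra.commutes, ← Algebra.smul_def, ← Algebra.smul_def,
        h2 x hx, h2' x hx, smul_smul, smul_smul, map_add, smul_add, pow_add, mul_comm]
  · rintro a b ha hb ⟨N, a', h1, h2⟩ ⟨N', b', h1', h2'⟩
    refine ⟨N + N', a' * b', ?_, fun x hx => ?_⟩
    · have : (⟨a * b, Subalgebra.mul_mem _ ha hb⟩ : GMN k n m') = ⟨a, ha⟩ * ⟨b, hb⟩ := rfl
      rw [this]
      have hc : ∀ z, Commute (α (scE k s hs) ^ N) z := fun z =>
        Commute.pow_left ((hα.comm s hs z).symm) N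
      rw [map_mul, map_mul, h1, h1', mul_assoc, ← mul_assoc (α (scE k s hs) ^ N), (hc _).eq, mul_assoc,
        mul_assoc, ← pow_add]
    · rw [MulMemClass.coe_mul, map_mul, h2 x hx, h2' x hx, smul_mul_smul_comm, map_mul, pow_add]

lemma exists_u {n m m' : ℕ} {A : Type} [Ring A] [Algebra k A]
    {X : Set (MTuple k n m)}
    {α : GMN k n m →ₐ[k] A} (hα : Model k X α) {α' : GMN k n m' →ₐ[k] A}
    (Y : Fin m' → GMN k n m') (hY : ∀ i, (Y i : MatPoly k n m') = genericMatrix k n m' i)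
    (P : Fin m' → GMN k n m) (s : PolyRing k n m) (hs : sc k s ∈ GMN k n m)
    (hP : ∀ i, α' (Y i) * α (scE k s hs) = α (P i))
    (t : PolyRing k n m') (ht : sc k t ∈ GMN k n m') :
    ∃ (M : ℕ) (u : PolyRing k n m) (hu : sc k u ∈ GMN k n m),
      α (scE k u hu) = α' (scE k t ht) * α (scE k s hs) ^ M ∧
      ∀ x, polyEval k x s ≠ 0 → polyEval k x u = polyEval k x s ^ M * polyEval k (rv k P s x) t := by
  obtain ⟨N, d, hd, hdx⟩ := nch k hα Y hY P s hs hP _ ht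
  obtain ⟨N', τ, hτ⟩ := homogenize k (fun i => (P i : MatPoly k n m)) s t
  have hτ' : ∀ x, polyEval k x s ≠ 0 →
      polyEval k x τ = polyEval k x s ^ N' * polyEval k (rv k P s x) t := fun x hx =>
    hτ k (polyEval k x) hx
  have key : sc k (τ * s ^ (N + 1)) = ((d * scE k s hs ^ (N' + 1) : GMN k n m) : MatPoly k n m) := by
    have hx : ∀ x : MTuple k n m, evalMat k x (sc k (τ * s ^ (N + 1))) =
        evalMat k x ((d * scE k s hs ^ (N' + 1) : GMN k n m) : MatPoly k n m) := by
      intro x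
      rw [MulMemClass.coe_mul, SubmonoidClass.coe_pow, map_mul, map_pow, eval_scE',
        evalMat_eq_gevM, eval_sc, ← evalMat_eq_gevM, ← polyEval_eq_gev, map_mul (polyEval k x),
        map_pow (polyEval k x)]
      by_cases h0 : polyEval k x s = 0
      · simp [h0]
      · rw [hdx x h0, hτ' x h0, evalMat_eq_gevM k (rv k P s x), eval_sc, ← polyEval_eq_gev,
          Algebra.smul_def, ← map_mul (algebraMap k (Matrix (Fin n) (Fin n) k)), ← map_pow (algebraMap k (Matrix (Fin n) (Fin n) k)), ← map_mul (algebraMap k (Matrix (Fin n) (Fin n) k))]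
        congr 1; ring
    ext i j
    apply congrArg
    apply MvPolynomial.funext
    intro z
    have := congrFun (congrFun (hx (fun h => Matrix.of fun a b => z (h, a, b))) i) j
    have e : ∀ p : PolyRing k n m, polyEval k (fun h => Matrix.of fun a b => z (h, a, b)) p =
        MvPolynomial.eval z p := by
      intro p; simp [polyEval, MvPolynomial.aeval_eq_eval]
    have e2 : ∀ p : MatPoly k n m, evalMat k (fun h => Matrix.of fun a b => z (h, a, b)) p i j =
        MvPolynomial.eval z (p i j) := fun p => e _
    rwa [e2, e2] at this
  refine ⟨N + (N' + 1), τ * s ^ (N + 1), by rw [key]; exact Subtype.property _, ?_, fun x hx => ?_⟩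
  · have : scE k (τ * s ^ (N + 1)) (by rw [key]; exact Subtype.property _) = d * scE k s hs ^ (N' + 1) := by
      ext1; exact key
    rw [this, map_mul, hd, map_pow, mul_assoc, ← pow_add]; rfl
  · rw [map_mul, map_pow, hτ' x hx]; ring

lemma round_trip {n m m' : ℕ} {A : Type} [Ring A] [Algebra k A]
    {X : Set (MTuple k n m)}
    {α : GMN k n m →ₐ[k] A} (hα : Model k X α) {α' : GMN k n m' →ₐ[k] A}
    (Y : Fin m' → GMN k n m') (hY : ∀ i, (Y i : MatPoly k n m') = genericMatrix k n m' i)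
    (P : Fin m' → GMN k n m) (s : PolyRing k n m) (hs : sc k s ∈ GMN k n m)
    (hP : ∀ i, α' (Y i) * α (scE k s hs) = α (P i))
    (Xg : Fin m → GMN k n m) (hXg : ∀ i, (Xg i : MatPoly k n m) = genericMatrix k n m i)
    (Q : Fin m → GMN k n m') (t : PolyRing k n m') (ht : sc k t ∈ GMN k n m')
    (hQ : ∀ i, α (Xg i) * α' (scE k t ht) = α' (Q i))
    (x : MTuple k n m) (hx : x ∈ X) (hxs : polyEval k x s ≠ 0)
    (hxt : polyEval k (rv k P s x) t ≠ 0) : rv k Q t (rv k P s x) = x := by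
  funext h
  obtain ⟨M, u, hu, hαu, hux⟩ := exists_u k hα Y hY P s hs hP t ht
  obtain ⟨N, q, hq, hqx⟩ := nch k hα Y hY P s hs hP _ (Q h).2
  have e1 : α (Xg h * scE k u hu * scE k s hs ^ N) = α (q * scE k s hs ^ M) := by
    rw [map_mul, map_mul, map_mul, hαu, hq, map_pow, map_pow, ← mul_assoc, hQ, mul_assoc, mul_assoc,
      ← pow_add, ← pow_add, add_comm]
  have e2 := (hα.eq_iff _ _).mp e1 x hx
  simp only [MulMemClass.coe_mul, SubmonoidClass.coe_pow, map_mul, map_pow, eval_scE'] at e2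
  rw [hXg, evalMat_eq_gevM, gevM_generic, ← evalMat_eq_gevM, hqx x hxs, hux x hxs, ← map_pow (algebraMap k (Matrix (Fin n) (Fin n) k)), ← map_pow (algebraMap k (Matrix (Fin n) (Fin n) k)),
    mul_assoc, ← map_mul (algebraMap k (Matrix (Fin n) (Fin n) k)), ← Algebra.commutes, ← Algebra.commutes, ← Algebra.smul_def,
    ← Algebra.smul_def, smul_smul, mul_right_comm, mul_smul, ← pow_add] at e2
  have e3 := smul_right_injective _ (pow_ne_zero (M + N) hxs) e2
  rw [rv, ← e3, smul_smul, inv_mul_cancel₀ hxt, one_smul]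

lemma gen_of_round {n m m' : ℕ} (Q : Fin m → GMN k n m') (t : PolyRing k n m')
    (x : MTuple k n m) (hx : x ∈ genTuples k n m) (y : MTuple k n m') (h : rv k Q t y = x) :
    y ∈ genTuples k n m' := by
  have h1 : ∀ p ∈ GMN k n m', evalMat k y p ∈ Algebra.adjoin k (Set.range y) := by
    intro p hp
    have : evalMat k y p ∈ (GMN k n m').map (evalMat k y) := ⟨p, hp, rfl⟩
    rw [GMN, AlgHom.map_adjoin, ← Set.range_comp] at this
    have h2 : (evalMat k y) ∘ genericMatrix k n m' = y := by
      funext h; exact gevM_generic k y h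
    rwa [h2] at this
  change Algebra.adjoin k (Set.range y) = ⊤
  rw [eq_top_iff, ← (show Algebra.adjoin k (Set.range x) = ⊤ from hx), Algebra.adjoin_le_iff]
  rintro _ ⟨i, rfl⟩
  rw [← h]
  exact Subalgebra.smul_mem _ (h1 _ (Q i).2) _

lemma ratVal_eq {n m l : ℕ} (P : Fin l → GMN k n m) (s u : PolyRing k n m) (hu : sc k u ∈ GMN k n m)
    (x : MTuple k n m) (hsu : polyEval k x (s * u) ≠ 0) :
    ratVal k (fun i => ((P i * scE k u hu : GMN k n m) : MatPoly k n m)) (sc k (s * u)) x = rv k P s x := by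
  funext i
  rw [map_mul] at hsu
  have h1 : (evalMat k x (sc k (s * u)))⁻¹ = algebraMap k _ (polyEval k x s * polyEval k x u)⁻¹ := by
    apply Matrix.inv_eq_right_inv
    rw [evalMat_eq_gevM, eval_sc, ← polyEval_eq_gev, map_mul (polyEval k x), ← map_mul, mul_inv_cancel₀ hsu, map_one]
  rw [ratVal, h1, rv, MulMemClass.coe_mul, map_mul, eval_scE', ← Algebra.commutes, ← Algebra.smul_def,
    ← Algebra.smul_def, smul_smul]
  congr 1
  have := (mul_ne_zero_iff.mp hsu)
  field_simp [this.1, this.2]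

lemma evalMat_sc_ne {n m : ℕ} (hn : 1 ≤ n) (x : MTuple k n m) (s : PolyRing k n m) :
    evalMat k x (sc k s) ≠ 0 ↔ polyEval k x s ≠ 0 := by
  rw [evalMat_eq_gevM, eval_sc, ← polyEval_eq_gev]
  refine ⟨fun h h0 => h (by rw [h0, map_zero]), fun h => sc_ne hn h⟩

lemma half {n m m' : ℕ} (hn : 1 ≤ n) {X : Set (MTuple k n m)} {X' : Set (MTuple k n m')}
    (hXi' : IsIrredSubset k X')
    (P : Fin m' → GMN k n m) (s u : PolyRing k n m) (hs : sc k s ∈ GMN k n m) (hu : sc k u ∈ GMN k n m)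
    (Q : Fin m → GMN k n m') (t v : PolyRing k n m')
    (hsu : ∀ x, polyEval k x (s * u) ≠ 0 ↔ polyEval k x s ≠ 0 ∧ polyEval k (rv k P s x) t ≠ 0)
    (htv : ∀ y, polyEval k y (t * v) ≠ 0 ↔ polyEval k y t ≠ 0 ∧ polyEval k (rv k Q t y) s ≠ 0)
    (hne : ∃ x ∈ X, polyEval k x (s * u) ≠ 0)
    (hne' : ∃ x ∈ X', polyEval k x (t * v) ≠ 0)
    (h1 : ∀ x ∈ X, polyEval k x s ≠ 0 → polyEval k (rv k P s x) t ≠ 0 → rv k P s x ∈ X')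
    (h2 : ∀ x ∈ X, polyEval k x s ≠ 0 → polyEval k (rv k P s x) t ≠ 0 → rv k Q t (rv k P s x) = x)
    (h3 : ∀ y ∈ X', polyEval k y t ≠ 0 → polyEval k (rv k Q t y) s ≠ 0 → rv k Q t y ∈ X)
    (h4 : ∀ y ∈ X', polyEval k y t ≠ 0 → polyEval k (rv k Q t y) s ≠ 0 → rv k P s (rv k Q t y) = y) :
    IsNRatMapOn k X X' (fun i => ((P i * scE k u hu : GMN k n m) : MatPoly k n m)) (sc k (s * u)) ∧
    IsDominantOn k X X' (fun i => ((P i * scE k u hu : GMN k n m) : MatPoly k n m)) (sc k (s * u)) ∧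
    (∃ x ∈ X, evalMat k x (sc k (s * u)) ≠ 0 ∧ evalMat k
      (ratVal k (fun i => ((P i * scE k u hu : GMN k n m) : MatPoly k n m)) (sc k (s * u)) x)
      (sc k (t * v)) ≠ 0) := by
  refine ⟨⟨fun i => Subtype.property _, ?_, ?_, ?_, ?_⟩, ?_, ?_⟩
  · rw [sc, map_mul]; exact Subalgebra.mul_mem _ hs hu
  · intro r _; exact Algebra.commutes _ _
  · obtain ⟨x, hx, h⟩ := hne
    exact ⟨x, hx, (evalMat_sc_ne k hn x _).mpr h⟩
  · intro x hx h
    rw [evalMat_sc_ne k hn] at h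
    rw [ratVal_eq k P s u hu x h]
    exact h1 x hx ((hsu x).mp h).1 ((hsu x).mp h).2
  · intro C hC hCx
    rcases hXi'.2 C {a | ∀ p ∈ ({t * v} : Set (PolyRing k n m')), polyEval k a p = 0} hC ⟨_, rfl⟩ (by
      intro y hy
      by_cases h0 : polyEval k y (t * v) = 0
      · right; simpa using h0
      · left
        obtain ⟨ha, hb⟩ := (htv y).mp h0
        have e := h4 y hy ha hb
        have h5 : polyEval k (rv k Q t y) (s * u) ≠ 0 := by
          rw [hsu, e]; exact ⟨hb, ha⟩
        have := hCx _ (h3 y hy ha hb) ((evalMat_sc_ne k hn _ _).mpr h5)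
        rw [ratVal_eq k P s u hu _ h5, e] at this
        exact this) with h | h
    · exact h
    · obtain ⟨y, hy, hh⟩ := hne'
      exact absurd (h hy _ rfl) hh
  · obtain ⟨x, hx, h⟩ := hne
    refine ⟨x, hx, (evalMat_sc_ne k hn x _).mpr h, ?_⟩
    rw [evalMat_sc_ne k hn, ratVal_eq k P s u hu x h, htv]
    obtain ⟨ha, hb⟩ := (hsu x).mp h
    rw [h2 x hx ha hb]
    exact ⟨hb, ha⟩

lemma u_props {n m m' : ℕ} {A : Type} [Ring A] [Nontrivial A] [Algebra k A]
    {X : Set (MTuple k n m)} {X' : Set (MTuple k n m')}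
    {α : GMN k n m →ₐ[k] A} (hα : Model k X α) {α' : GMN k n m' →ₐ[k] A} (hα' : Model k X' α')
    (Y : Fin m' → GMN k n m') (hY : ∀ i, (Y i : MatPoly k n m') = genericMatrix k n m' i)
    (P : Fin m' → GMN k n m) (s : PolyRing k n m) (hs : sc k s ∈ GMN k n m)
    (hsX : ∃ x ∈ X, polyEval k x s ≠ 0)
    (hP : ∀ i, α' (Y i) * α (scE k s hs) = α (P i))
    (t : PolyRing k n m') (ht : sc k t ∈ GMN k n m') (htX : ∃ x ∈ X', polyEval k x t ≠ 0) :
    ∃ (u : PolyRing k n m) (_ : sc k u ∈ GMN k n m),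
      (∀ x, polyEval k x (s * u) ≠ 0 ↔ polyEval k x s ≠ 0 ∧ polyEval k (rv k P s x) t ≠ 0) ∧
      ∃ x ∈ X, polyEval k x (s * u) ≠ 0 := by
  obtain ⟨M, u, hu, hαu, hux⟩ := exists_u k hα Y hY P s hs hP t ht
  refine ⟨u, hu, ?_, ?_⟩
  · intro x
    rw [map_mul, mul_ne_zero_iff]
    refine and_congr_right fun h => ?_
    rw [hux x h, mul_ne_zero_iff]
    exact ⟨fun h => h.2, fun h' => ⟨pow_ne_zero _ h, h'⟩⟩
  · by_contra! h
    have hsu : α (scE k s hs * scE k u hu) = 0 := by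
      rw [hα.ker]
      intro x hx
      rw [MulMemClass.coe_mul, map_mul, eval_scE', eval_scE', ← map_mul, ← map_mul, h x hx, map_zero]
    have hun : IsUnit (α (scE k s hs * scE k u hu)) := by
      rw [map_mul, hαu]
      have h1 := hα.unit s hs hsX
      exact h1.mul ((hα'.unit t ht htX).mul (h1.pow M))
    rw [hsu] at hun
    exact not_isUnit_zero hun

lemma maps_into {n m m' : ℕ} (hn : 1 ≤ n) {X : Set (MTuple k n m)} {X' : Set (MTuple k n m')}
    (hX : IsNVariety k X) (hXi : IsIrredSubset k X)
    (hX' : IsNVariety k X') (hXi' : IsIrredSubset k X')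
    {K : Type} [Field K] [Algebra k K] {A : Type} [Ring A] [Algebra K A] [Algebra k A]
    [IsScalarTower k K A] (hdeg : Module.finrank K A = n ^ 2)
    {α : GMN k n m →ₐ[k] A} (hα : Model k X α) {α' : GMN k n m' →ₐ[k] A} (hα' : Model k X' α')
    (Y : Fin m' → GMN k n m') (hY : ∀ i, (Y i : MatPoly k n m') = genericMatrix k n m' i)
    (P : Fin m' → GMN k n m) (s : PolyRing k n m) (hs : sc k s ∈ GMN k n m)
    (hsX : ∃ x ∈ X, polyEval k x s ≠ 0)
    (hP : ∀ i, α' (Y i) * α (scE k s hs) = α (P i))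
    (Q : Fin m → GMN k n m') (t : PolyRing k n m')
    (x : MTuple k n m) (hx : x ∈ X) (hxs : polyEval k x s ≠ 0)
    (hr : rv k Q t (rv k P s x) = x) : rv k P s x ∈ X' := by
  obtain ⟨hU', hinv, C, ⟨S, hS⟩, hC⟩ := hX'
  have hyU := gen_of_round k Q t x (hX.1 hx) _ hr
  rw [hC]
  refine ⟨?_, hyU⟩
  rw [hS]
  intro p hp
  refine closed_half k hn hX.1 hXi hU' hXi' hinv hdeg hα hα' Y hY P s hs hsX hP p ?_ x hx hxs
  intro x' hx'
  rw [hC, hS] at hx'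
  exact hx'.1 p hp

theorem uniqueness {n m m' : ℕ} (hn : 1 ≤ n) {X : Set (MTuple k n m)} {X' : Set (MTuple k n m')}
    (hX : IsNVariety k X) (hXi : IsIrredSubset k X)
    (hX' : IsNVariety k X') (hXi' : IsIrredSubset k X')
    {K : Type} [Field K] [Algebra k K] {A : Type} [Ring A] [Nontrivial A] [Algebra K A] [Algebra k A]
    [IsScalarTower k K A] (hdeg : Module.finrank K A = n ^ 2)
    {α : GMN k n m →ₐ[k] A} (hα : Model k X α) {α' : GMN k n m' →ₐ[k] A} (hα' : Model k X' α') :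
    NBirational k X X' := by
  let Xg : Fin m → GMN k n m := fun i => ⟨genericMatrix k n m i, Algebra.subset_adjoin ⟨i, rfl⟩⟩
  let Y : Fin m' → GMN k n m' := fun i => ⟨genericMatrix k n m' i, Algebra.subset_adjoin ⟨i, rfl⟩⟩
  have hXg : ∀ i, (Xg i : MatPoly k n m) = genericMatrix k n m i := fun _ => rfl
  have hY : ∀ i, (Y i : MatPoly k n m') = genericMatrix k n m' i := fun _ => rfl
  obtain ⟨P, s, hs, hsX, hP⟩ := hα.fracs hXi (fun i => α' (Y i))
  obtain ⟨Q, t, ht, htX, hQ⟩ := hα'.fracs hXi' (fun i => α (Xg i))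
  obtain ⟨u, hu, hsu, hne⟩ := u_props k hα hα' Y hY P s hs hsX hP t ht htX
  obtain ⟨v, hv, htv, hne'⟩ := u_props k hα' hα Xg hXg Q t ht htX hQ s hs hsX
  have h2 : ∀ x ∈ X, polyEval k x s ≠ 0 → polyEval k (rv k P s x) t ≠ 0 → rv k Q t (rv k P s x) = x :=
    fun x hx ha hb => round_trip k hα Y hY P s hs hP Xg hXg Q t ht hQ x hx ha hb
  have h4 : ∀ y ∈ X', polyEval k y t ≠ 0 → polyEval k (rv k Q t y) s ≠ 0 → rv k P s (rv k Q t y) = y :=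
    fun x hx ha hb => round_trip k hα' Xg hXg Q t ht hQ Y hY P s hs hP x hx ha hb
  have h1 : ∀ x ∈ X, polyEval k x s ≠ 0 → polyEval k (rv k P s x) t ≠ 0 → rv k P s x ∈ X' :=
    fun x hx ha hb => maps_into k hn hX hXi hX' hXi' hdeg hα hα' Y hY P s hs hsX hP Q t x hx ha
      (h2 x hx ha hb)
  have h3 : ∀ y ∈ X', polyEval k y t ≠ 0 → polyEval k (rv k Q t y) s ≠ 0 → rv k Q t y ∈ X :=
    fun x hx ha hb => maps_into k hn hX' hXi' hX hXi hdeg hα' hα Xg hXg Q t ht htX hQ P s x hx ha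
      (h4 x hx ha hb)
  obtain ⟨a1, a2, a3⟩ := half k hn hXi' P s u hs hu Q t v hsu htv hne hne' h1 h2 h3 h4
  obtain ⟨b1, b2, b3⟩ := half k hn hXi Q t v ht hv P s u htv hsu hne' hne h3 h4 h1 h2
  refine ⟨_, _, _, _, a1, b1, a2, b2, a3, b3, ?_, ?_⟩
  · intro x hx hc hd
    rw [evalMat_sc_ne k hn] at hc hd
    rw [ratVal_eq k P s u hu x hc] at hd ⊢
    rw [ratVal_eq k Q t v hv _ hd]
    exact h2 x hx ((hsu x).mp hc).1 ((hsu x).mp hc).2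
  · intro x hx hc hd
    rw [evalMat_sc_ne k hn] at hc hd
    rw [ratVal_eq k Q t v hv x hc] at hd ⊢
    rw [ratVal_eq k P s u hu _ hd]
    exact h4 x hx ((htv x).mp hc).1 ((htv x).mp hc).2
end PH
end

noncomputable section
section PI

lemma gmap_inv {n : ℕ} (F : Type) [Field F] [Algebra k F] (g : GL (Fin n) k) :
    (gmap k F g)⁻¹ = gmap k F g⁻¹ := by
  apply Matrix.inv_eq_right_inv
  rw [gmap, gmap, ← Matrix.map_mul, ← Units.val_mul, mul_inv_cancel]
  simp

/-- The substitution of a conjugate tuple of generic matrices. -/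
lemma conj_subst {n m : ℕ} (g : GL (Fin n) k) (q : PolyRing k n m) :
    ∃ q' : PolyRing k n m, ∀ (F : Type) [Field F] [Algebra k F] (y : Fin m → Matrix (Fin n) (Fin n) F),
      gev k y q' = gev k (fun i => gmap k F g * y i * (gmap k F g)⁻¹) q := by
  let G : Fin m → MatPoly k n m := fun i =>
    (g : Matrix (Fin n) (Fin n) k).map (algebraMap k (PolyRing k n m)) * genericMatrix k n m i *
      ((g⁻¹ : GL (Fin n) k) : Matrix (Fin n) (Fin n) k).map (algebraMap k (PolyRing k n m))
  refine ⟨gev k G q, ?_⟩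
  intro F _ _ y
  rw [gev_comp, gmap_inv]
  congr 1
  congr 1
  funext i
  have h1 : ∀ M : Matrix (Fin n) (Fin n) k, (gevM k y) (M.map (algebraMap k (PolyRing k n m))) =
      M.map (algebraMap k F) := by
    intro M; ext a b; simp [gevM]
  have : (gevM k y) (G i) = gmap k F g * y i * gmap k F g⁻¹ := by
    simp only [G, map_mul, gevM_generic, h1, gmap]
  exact this

/-- The ideal of polynomials vanishing on the orbit of `ξ`. -/
def orbIdeal {n m : ℕ} {Ω : Type} [Field Ω] [Algebra k Ω]
    (ξ : Fin m → Matrix (Fin n) (Fin n) Ω) : Ideal (PolyRing k n m) where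
  carrier := {q | ∀ g : GL (Fin n) k, gev k (fun i => gmap k Ω g * ξ i * (gmap k Ω g)⁻¹) q = 0}
  zero_mem' := fun g => map_zero _
  add_mem' := fun {p q} hp hq g => by rw [map_add, hp g, hq g, add_zero]
  smul_mem' := fun c q hq g => by rw [smul_eq_mul, map_mul, hq g, mul_zero]

lemma mem_orbIdeal {n m : ℕ} {Ω : Type} [Field Ω] [Algebra k Ω]
    (ξ : Fin m → Matrix (Fin n) (Fin n) Ω) (q : PolyRing k n m) :
    q ∈ orbIdeal k ξ ↔
      ∀ g : GL (Fin n) k, gev k (fun i => gmap k Ω g * ξ i * (gmap k Ω g)⁻¹) q = 0 := Iff.rfl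

lemma gmap_one {n : ℕ} (Ω : Type) [Field Ω] [Algebra k Ω] : gmap k Ω (1 : GL (Fin n) k) = 1 := by
  simp [gmap]

lemma orb_one {n m : ℕ} {Ω : Type} [Field Ω] [Algebra k Ω]
    (ξ : Fin m → Matrix (Fin n) (Fin n) Ω) {q : PolyRing k n m} (h : q ∈ orbIdeal k ξ) :
    gev k ξ q = 0 := by
  have := h 1
  simpa [gmap_one] using this

instance orb_prime {n m : ℕ} {Ω : Type} [Field Ω] [Algebra k Ω]
    (ξ : Fin m → Matrix (Fin n) (Fin n) Ω) : (orbIdeal k ξ).IsPrime := by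
  refine ⟨?_, fun {p q} h => orbit_prime k ξ p q h⟩
  rw [Ne, Ideal.eq_top_iff_one]
  intro h
  have := orb_one k ξ h
  rw [map_one] at this
  exact one_ne_zero this

lemma orb_conj {n m : ℕ} {Ω : Type} [Field Ω] [Algebra k Ω]
    (ξ : Fin m → Matrix (Fin n) (Fin n) Ω) {q q' : PolyRing k n m} (h : q ∈ orbIdeal k ξ)
    (g : GL (Fin n) k)
    (hq' : ∀ (F : Type) [Field F] [Algebra k F] (y : Fin m → Matrix (Fin n) (Fin n) F),
      gev k y q' = gev k (fun i => gmap k F g * y i * (gmap k F g)⁻¹) q) :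
    q' ∈ orbIdeal k ξ := by
  intro g'
  rw [hq', ← h (g * g')]
  congr 1
  congr 1
  funext i
  rw [gmap_inv, gmap_inv, gmap_inv, mul_inv_rev]
  have e : ∀ a b : GL (Fin n) k, gmap k Ω (a * b) = gmap k Ω a * gmap k Ω b := by
    intro a b; simp [gmap, Matrix.map_mul]
  rw [e, e]
  simp only [mul_assoc]

lemma nullst {n m : ℕ} (P : Ideal (PolyRing k n m)) [P.IsPrime] (q : PolyRing k n m)
    (h : ∀ x : MTuple k n m, (∀ p ∈ P, polyEval k x p = 0) → polyEval k x q = 0) : q ∈ P := by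
  have h1 := MvPolynomial.IsPrime.vanishingIdeal_zeroLocus (K := k) P
  rw [← h1, MvPolynomial.mem_vanishingIdeal_iff]
  intro z hz
  have e : ∀ p : PolyRing k n m, polyEval k (fun h => Matrix.of fun a b => z (h, a, b)) p =
      MvPolynomial.aeval z p := by
    intro p; simp [polyEval]
  rw [← e]
  apply h
  intro p hp
  rw [e]
  exact hz p hp

/-- The variety attached to a point over an extension field. -/
lemma exists_variety {n m : ℕ} {L : Type} [Field L] [Algebra k L]
    (ξ : Fin m → Matrix (Fin n) (Fin n) L) (e : Fin n × Fin n → Fin m)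
    (hdet : (Matrix.of fun i (x : Fin n × Fin n) => ξ (e i) x.1 x.2).det ≠ 0) :
    ∃ X : Set (MTuple k n m), IsNVariety k X ∧ IsIrredSubset k X ∧
      ∀ q, (∀ x ∈ X, polyEval k x q = 0) ↔ q ∈ orbIdeal k ξ := by
  let C : Set (MTuple k n m) := {a | ∀ p ∈ (orbIdeal k ξ : Set (PolyRing k n m)), polyEval k a p = 0}
  let D : PolyRing k n m :=
    (Matrix.of fun i (x : Fin n × Fin n) => genericMatrix k n m (e i) x.1 x.2).det
  have hD : ∀ (F : Type) [Field F] [Algebra k F] (y : Fin m → Matrix (Fin n) (Fin n) F),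
      gev k y D = (Matrix.of fun i (x : Fin n × Fin n) => y (e i) x.1 x.2).det := by
    intro F _ _ y
    rw [← AlgHom.coe_toRingHom, RingHom.map_det]
    congr 1
    ext i x
    simp [gev, genericMatrix]
  have hDP : D ∉ orbIdeal k ξ := by
    intro h
    have := orb_one k ξ h
    rw [hD] at this
    exact hdet this
  have hDU : ∀ x : MTuple k n m, polyEval k x D ≠ 0 → x ∈ genTuples k n m := by
    intro x hx
    rw [polyEval_eq_gev, hD] at hx
    have h1 := span_of_det (fun i => x (e i)) hx
    change Algebra.adjoin k (Set.range x) = ⊤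
    rw [eq_top_iff]
    intro M _
    have h2 : M ∈ Submodule.span k (Set.range fun i => x (e i)) := by rw [h1]; trivial
    have h3 : Submodule.span k (Set.range fun i => x (e i)) ≤
        Subalgebra.toSubmodule (Algebra.adjoin k (Set.range x)) := by
      rw [Submodule.span_le]
      rintro _ ⟨i, rfl⟩
      exact Algebra.subset_adjoin ⟨_, rfl⟩
    exact h3 h2
  have hq : ∀ q, (∀ x ∈ C ∩ genTuples k n m, polyEval k x q = 0) ↔ q ∈ orbIdeal k ξ := by
    intro q
    constructor
    · intro h
      have h1 : q * D ∈ orbIdeal k ξ := by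
        apply nullst
        intro x hx
        rw [map_mul]
        by_cases h0 : polyEval k x D = 0
        · rw [h0, mul_zero]
        · rw [h x ⟨hx, hDU x h0⟩, zero_mul]
      exact ((orb_prime k ξ).mem_or_mem h1).resolve_right hDP
    · intro h x hx
      exact hx.1 q h
  refine ⟨C ∩ genTuples k n m, ⟨Set.inter_subset_right, ?_, C, ⟨_, rfl⟩, rfl⟩, ⟨?_, ?_⟩, hq⟩
  · intro g a ha
    have hconj : ∀ q, polyEval k (conjAct k g a) q =
        gev k (fun i => gmap k k g * a i * (gmap k k g)⁻¹) q := by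
      intro q
      rw [gmap_inv, polyEval_eq_gev]
      congr 1
    refine ⟨?_, ?_⟩
    · intro p hp
      obtain ⟨p', hp'⟩ := conj_subst k g p
      rw [hconj, ← hp']
      exact ha.1 p' (orb_conj k ξ hp g hp')
    · have hM : ∀ M ∈ Algebra.adjoin k (Set.range a),
          (g : Matrix (Fin n) (Fin n) k) * M * ((g⁻¹ : GL (Fin n) k) : Matrix (Fin n) (Fin n) k) ∈
            Algebra.adjoin k (Set.range (conjAct k g a)) := by
        intro M hM
        induction hM using Algebra.adjoin_induction with
        | mem x hx =>
          obtain ⟨i, rfl⟩ := hx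
          exact Algebra.subset_adjoin ⟨i, rfl⟩
        | algebraMap r =>
          rw [← Algebra.commutes, mul_assoc, Units.mul_inv, mul_one]
          exact Subalgebra.algebraMap_mem _ r
        | add x y _ _ hx hy => rw [mul_add, add_mul]; exact add_mem hx hy
        | mul x y _ _ hx hy =>
          have := mul_mem hx hy
          simpa only [mul_assoc, Units.inv_mul_cancel_left] using this
      change Algebra.adjoin k (Set.range (conjAct k g a)) = ⊤
      rw [eq_top_iff]
      intro N _
      have hg : Algebra.adjoin k (Set.range a) = ⊤ := ha.2
      have := hM (((g⁻¹ : GL (Fin n) k) : Matrix (Fin n) (Fin n) k) * N * g) (by rw [hg]; trivial)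
      simpa only [mul_assoc, Units.mul_inv_cancel_left, Units.mul_inv, mul_one] using this
  · by_contra hne
    rw [Set.not_nonempty_iff_eq_empty] at hne
    have : (1 : PolyRing k n m) ∈ orbIdeal k ξ := by
      rw [← hq]; intro x hx; rw [hne] at hx; exact hx.elim
    exact (orb_prime k ξ).ne_top ((Ideal.eq_top_iff_one _).mpr this)
  · rintro _ _ ⟨S, rfl⟩ ⟨T, rfl⟩ hST
    by_contra! hcon
    obtain ⟨h1, h2⟩ := hcon
    rw [Set.not_subset] at h1 h2
    obtain ⟨x, hx, hxS⟩ := h1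
    obtain ⟨y, hy, hyT⟩ := h2
    simp only [Set.mem_ofPred_eq, not_forall] at hxS hyT
    obtain ⟨p, hp, hpx⟩ := hxS
    obtain ⟨q, hqT, hqy⟩ := hyT
    have h3 : p * q ∈ orbIdeal k ξ := by
      rw [← hq]
      intro z hz
      rw [map_mul]
      rcases hST hz with h | h
      · rw [h p hp, zero_mul]
      · rw [h q hqT, mul_zero]
    rcases (orb_prime k ξ).mem_or_mem h3 with h | h
    · exact hpx ((hq p).mpr h x hx)
    · exact hqy ((hq q).mpr h y hy)

lemma vanish_iff {n m : ℕ} {L : Type} [Field L] [Algebra k L]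
    (ξ : Fin m → Matrix (Fin n) (Fin n) L) {X : Set (MTuple k n m)}
    (hX : ∀ q, (∀ x ∈ X, polyEval k x q = 0) ↔ q ∈ orbIdeal k ξ)
    (p : MatPoly k n m) (hp : p ∈ GMN k n m) :
    (∀ x ∈ X, evalMat k x p = 0) ↔ gevM k ξ p = 0 := by
  have h1 : (∀ x ∈ X, evalMat k x p = 0) ↔ ∀ i j, p i j ∈ orbIdeal k ξ := by
    constructor
    · intro h i j
      rw [← hX]
      intro x hx
      exact congrFun (congrFun (h x hx) i) j
    · intro h x hx
      ext i j
      exact (hX _).mpr (h i j) x hx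
  rw [h1]
  constructor
  · intro h
    ext i j
    exact orb_one k ξ (h i j)
  · intro h i j g
    have h2 : gevM k (fun i => gmap k L g * ξ i * (gmap k L g)⁻¹) p =
        gmap k L g * gevM k ξ p * (gmap k L g)⁻¹ := by
      have hu : IsUnit (gmap k L g).det := (gmap_det k L g).isUnit
      clear h h1
      induction hp using Algebra.adjoin_induction with
      | mem x hx =>
        obtain ⟨i, rfl⟩ := hx
        rw [gevM_generic, gevM_generic]
      | algebraMap r =>
        rw [AlgHom.commutes, AlgHom.commutes, ← Algebra.commutes, mul_assoc,
          Matrix.mul_nonsing_inv _ hu, mul_one]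
      | add x y _ _ hx hy => rw [map_add, map_add, hx, hy, mul_add, add_mul]
      | mul x y _ _ hx hy =>
        rw [map_mul, map_mul, hx, hy]
        simp only [mul_assoc, Matrix.nonsing_inv_mul_cancel_left _ _ hu]
    rw [h, mul_zero, zero_mul] at h2
    exact congrFun (congrFun h2 i) j
end PI
end

noncomputable section
section PJ

lemma det_of_span {n : ℕ} {E : Type} [Field E] (w : Fin n × Fin n → Matrix (Fin n) (Fin n) E)
    (h : Submodule.span E (Set.range w) = ⊤) :
    (Matrix.of fun i (x : Fin n × Fin n) => w i x.1 x.2).det ≠ 0 := by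
  intro h0
  obtain ⟨v, hv, h1⟩ := Matrix.exists_mulVec_eq_zero_iff.mpr h0
  let φ : Matrix (Fin n) (Fin n) E →ₗ[E] E :=
    { toFun := fun M => ∑ x : Fin n × Fin n, M x.1 x.2 * v x
      map_add' := fun M N => by simp [add_mul, Finset.sum_add_distrib]
      map_smul' := fun c M => by simp [Finset.mul_sum, mul_assoc] }
  have h2 : ∀ M, φ M = 0 := by
    intro M
    have hM : M ∈ Submodule.span E (Set.range w) := by rw [h]; trivial
    have h3 : Submodule.span E (Set.range w) ≤ LinearMap.ker φ := by
      rw [Submodule.span_le]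
      rintro _ ⟨i, rfl⟩
      exact congrFun h1 i
    exact h3 hM
  apply hv
  funext x
  have h4 : φ (Matrix.single x.1 x.2 1) = v x := by
    change ∑ y : Fin n × Fin n, Matrix.single x.1 x.2 (1 : E) y.1 y.2 * v y = v x
    rw [Finset.sum_eq_single x]
    · simp
    · intro y _ hy
      rw [Matrix.single_apply_of_ne, zero_mul]
      rintro ⟨h5, h6⟩
      exact hy (Prod.ext h5.symm h6.symm)
    · simp
  rw [← h4, h2]; rfl

lemma exists_lift {n m : ℕ} {X : Set (MTuple k n m)} {A : Type} [Ring A] [Algebra k A]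
    (α : GMN k n m →ₐ[k] A) (h : ∀ p : GMN k n m, α p = 0 ↔ ∀ x ∈ X, evalMat k x p = 0) :
    ∃ f : coordRing k X →ₐ[k] A, Function.Injective f ∧ ∀ p, f (resGMN k X p) = α p := by
  have h1 : ∀ p q : GMN k n m, α p = α q ↔ resGMN k X p = resGMN k X q := by
    intro p q
    rw [resGMN_eq, ← sub_eq_zero, ← map_sub, h]
    simp [sub_eq_zero]
  let r := Function.surjInv (resGMN_surj k X)
  have hr : ∀ c, resGMN k X (r c) = c := Function.surjInv_eq (resGMN_surj k X)
  have h2 : ∀ p, α (r (resGMN k X p)) = α p := fun p => (h1 _ _).mpr (hr _)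
  refine ⟨
    { toFun := fun c => α (r c)
      map_one' := by rw [← map_one (resGMN k X), h2, map_one]
      map_zero' := by rw [← map_zero (resGMN k X), h2, map_zero]
      map_mul' := fun c d => by
        rw [← map_mul, h1, map_mul, hr, hr, hr]
      map_add' := fun c d => by
        rw [← map_add, h1, map_add, hr, hr, hr]
      commutes' := fun t => by
        rw [← AlgHom.commutes (resGMN k X), h2, AlgHom.commutes] }, ?_, h2⟩
  intro c d hcd
  have := (h1 _ _).mp hcd
  rwa [hr, hr] at this

lemma exists_alpha {n m : ℕ} {A L : Type} [Ring A] [Algebra k A] [Field L] [Algebra k L]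
    (β : A →ₐ[k] Matrix (Fin n) (Fin n) L) (hβ : Function.Injective β) (gens : Fin m → A) :
    ∃ α : GMN k n m →ₐ[k] A, (∀ p, β (α p) = gevM k (fun i => β (gens i)) p) := by
  have h1 : ∀ p : GMN k n m, gevM k (fun i => β (gens i)) p ∈ β.range := by
    rintro ⟨p, hp⟩
    have : gevM k (fun i => β (gens i)) p ∈ (GMN k n m).map (gevM k (fun i => β (gens i))) :=
      ⟨p, hp, rfl⟩
    rw [GMN, AlgHom.map_adjoin] at this
    refine Algebra.adjoin_le ?_ this
    rintro _ ⟨_, ⟨i, rfl⟩, rfl⟩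
    rw [SetLike.mem_coe, gevM_generic]
    exact ⟨_, rfl⟩
  refine ⟨((AlgEquiv.ofInjective β hβ).symm : β.range →ₐ[k] A).comp
    (((gevM k (fun i => β (gens i))).comp (GMN k n m).val).codRestrict β.range h1), fun p => ?_⟩
  have : ∀ y : β.range, β ((AlgEquiv.ofInjective β hβ).symm y) = y := by
    intro y
    have := congrArg Subtype.val ((AlgEquiv.ofInjective β hβ).apply_symm_apply y)
    exact this
  exact this _

lemma existence (n : ℕ) (hn : 1 ≤ n)
    (K : Type) [Field K] [Algebra k K]
    (hKfg : ∃ s : Finset K, IntermediateField.adjoin k (s : Set K) = ⊤)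
    (A : Type) [Ring A] [Algebra K A] [Algebra k A] [IsScalarTower k K A]
    (hsimple : IsSimpleRing A)
    (hcenter : (algebraMap K A).range = Subring.center A)
    (hdeg : Module.finrank K A = n ^ 2) :
    ∃ (m : ℕ), 2 ≤ m ∧ ∃ X : Set (MTuple k n m),
      IsNVariety k X ∧ IsIrredSubset k X ∧
      ∃ f : ↥(coordRing k X) →ₐ[k] A, IsTotalFracHom k f := by
  classical
  obtain ⟨s, hs⟩ := hKfg
  obtain ⟨β₀, hspan⟩ := exists_split hsimple hcenter n hn hdeg
  set L := AlgebraicClosure K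
  let β : A →ₐ[k] Matrix (Fin n) (Fin n) L := β₀.restrictScalars k
  have : Nonempty (Fin n) := ⟨⟨0, hn⟩⟩
  have hβ : Function.Injective β := (β₀ : A →+* Matrix (Fin n) (Fin n) L).injective
  have hfin : Module.Finite K A := Module.finite_of_finrank_pos (by rw [hdeg]; positivity)
  let b : Module.Basis (Fin n × Fin n) K A :=
    (Module.finBasisOfFinrankEq K A hdeg).reindex (Fintype.equivOfCardEq (by simp [sq]))
  let ι := (Fin n × Fin n) ⊕ (s ⊕ Fin 2)
  let ge : ι → A := Sum.elim b (Sum.elim (fun x => algebraMap K A x) (fun _ => 0))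
  let eqv : ι ≃ Fin (Fintype.card ι) := Fintype.equivFin ι
  let gens : Fin (Fintype.card ι) → A := fun i => ge (eqv.symm i)
  have hge : ∀ i, gens (eqv i) = ge i := fun i => by simp [gens]
  have hdet : (Matrix.of fun i (x : Fin n × Fin n) =>
      (fun j => β (gens j)) (eqv (Sum.inl i)) x.1 x.2).det ≠ 0 := by
    refine det_of_span (fun i => β (gens (eqv (Sum.inl i)))) ?_
    rw [eq_top_iff, ← hspan, Submodule.span_le]
    rintro _ ⟨a, rfl⟩
    rw [← b.sum_repr a, map_sum]
    refine Submodule.sum_mem _ fun i _ => ?_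
    rw [map_smul, ← algebraMap_smul L]
    refine Submodule.smul_mem _ _ (Submodule.subset_span ⟨i, ?_⟩)
    simp only [hge]
    rfl
  obtain ⟨X, hXv, hXi, hX⟩ := exists_variety k (fun j => β (gens j)) (fun i => eqv (Sum.inl i)) hdet
  obtain ⟨α, hα⟩ := exists_alpha k β hβ gens
  have hker : ∀ p : GMN k n (Fintype.card ι), α p = 0 ↔ ∀ x ∈ X, evalMat k x p = 0 := by
    intro p
    rw [vanish_iff k _ hX p p.2, ← hα, map_eq_zero_iff β hβ]
  obtain ⟨f, hf, hfα⟩ := exists_lift k α hker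
  have hgen : ∀ i, ge i ∈ α.range := by
    intro i
    refine ⟨⟨genericMatrix k n _ (eqv i), Algebra.subset_adjoin ⟨_, rfl⟩⟩, hβ ?_⟩
    have := hα ⟨genericMatrix k n _ (eqv i), Algebra.subset_adjoin ⟨_, rfl⟩⟩
    rw [gevM_generic, hge] at this
    exact this
  have hcomm : ∀ a : A, (∀ p, α p * a = a * α p) → a ∈ Subring.center A := by
    intro a ha
    rw [Subring.mem_center_iff]
    intro c
    rw [← b.sum_repr c, Finset.sum_mul, Finset.mul_sum]
    refine Finset.sum_congr rfl fun i _ => ?_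
    obtain ⟨p, hp⟩ := hgen (Sum.inl i)
    have hp' : α p = b i := hp
    rw [smul_mul_assoc, mul_smul_comm, ← hp', ha]
  have hR : ∀ r ∈ Algebra.adjoin k (s : Set K), algebraMap K A r ∈ α.range := by
    intro r hr
    induction hr using Algebra.adjoin_induction with
    | mem x hx => exact hgen (Sum.inr (Sum.inl ⟨x, hx⟩))
    | algebraMap t =>
      rw [← IsScalarTower.algebraMap_apply]
      exact Subalgebra.algebraMap_mem _ t
    | add x y _ _ hx hy => rw [map_add]; exact add_mem hx hy
    | mul x y _ _ hx hy => rw [map_mul]; exact mul_mem hx hy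
  have hfr : ∀ q : A, ∃ c ∈ Algebra.adjoin k (s : Set K), c ≠ 0 ∧ algebraMap K A c * q ∈ α.range := by
    intro q
    have hq : q ∈ Submodule.span K (Set.range b) := by rw [b.span_eq]; trivial
    induction hq using Submodule.span_induction with
    | mem x hx =>
      obtain ⟨i, rfl⟩ := hx
      exact ⟨1, one_mem _, one_ne_zero, by rw [map_one, one_mul]; exact hgen (Sum.inl i)⟩
    | zero => exact ⟨1, one_mem _, one_ne_zero, by rw [mul_zero]; exact zero_mem _⟩
    | add x y _ _ hx hy =>
      obtain ⟨c, hc, hc0, hcx⟩ := hx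
      obtain ⟨d, hd, hd0, hdy⟩ := hy
      refine ⟨c * d, mul_mem hc hd, mul_ne_zero hc0 hd0, ?_⟩
      have e : algebraMap K A (c * d) * (x + y) = algebraMap K A d * (algebraMap K A c * x) +
          algebraMap K A c * (algebraMap K A d * y) := by
        rw [mul_add, ← mul_assoc, ← mul_assoc, ← map_mul, ← map_mul, mul_comm d c]
      rw [e]
      exact add_mem (mul_mem (hR d hd) hcx) (mul_mem (hR c hc) hdy)
    | smul κ x _ hx =>
      obtain ⟨c, hc, hc0, hcx⟩ := hx
      have hκ : κ ∈ IntermediateField.adjoin k (s : Set K) := by rw [hs]; trivial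
      obtain ⟨r, hr, d, hd, rfl⟩ := IntermediateField.mem_adjoin_iff_div.mp hκ
      by_cases hd0 : d = 0
      · refine ⟨1, one_mem _, one_ne_zero, ?_⟩
        rw [hd0, div_zero, zero_smul, mul_zero]
        exact zero_mem _
      · refine ⟨c * d, mul_mem hc hd, mul_ne_zero hc0 hd0, ?_⟩
        have e : algebraMap K A (c * d) * ((r / d) • x) = algebraMap K A r * (algebraMap K A c * x) := by
          rw [Algebra.smul_def, ← mul_assoc, ← mul_assoc, ← map_mul, ← map_mul]
          congr 2
          field_simp
        rw [e]
        exact mul_mem (hR r hr) hcx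
  refine ⟨Fintype.card ι, by simp only [ι, Fintype.card_sum, Fintype.card_fin]; omega,
    X, hXv, hXi, f, hf, ?_, ?_⟩
  · intro c hc hc0
    rw [Subring.mem_center_iff] at hc
    have h1 : f c ∈ Subring.center A := by
      apply hcomm
      intro p
      rw [← hfα, ← map_mul, hc, map_mul]
    rw [← hcenter] at h1
    obtain ⟨κ, hκ⟩ := h1
    have hκ0 : κ ≠ 0 := by
      rintro rfl
      rw [map_zero] at hκ
      exact hc0 ((map_eq_zero_iff f hf).mp hκ.symm)
    rw [← hκ]
    exact (hκ0.isUnit).map (algebraMap K A)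
  · intro q
    obtain ⟨c, hc, hc0, r, hr⟩ := hfr q
    obtain ⟨p, hp⟩ := hR c hc
    have hr' : α r = algebraMap K A c * q := hr
    have hp' : α p = algebraMap K A c := hp
    refine ⟨resGMN k X r, resGMN k X p, ?_, ?_, ?_⟩
    · rw [Subring.mem_center_iff]
      intro d
      apply hf
      rw [map_mul, map_mul, hfα, hp', Algebra.commutes]
    · intro h0
      have : α p = 0 := by rw [← hfα, h0, map_zero]
      rw [hp'] at this
      exact hc0 ((map_eq_zero_iff _ (algebraMap K A).injective).mp this)
    · rw [hfα, hfα, hp', hr', Algebra.commutes]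
end PJ
end

/-- **Statement 18** (Theorem thm.W(A)).  Let `K/k` be a finitely generated field
extension and `A` a central simple algebra of degree `n` with center `K`.  Then
`A` is isomorphic as a `k`-algebra to `k_n(X)` (the total ring of fractions of
`k_n[X]`) for some irreducible `n`-variety `X`.  Moreover `X` is uniquely
determined by `A` up to birational isomorphism of `n`-varieties. -/
theorem csa_is_rational_function_algebra (n : ℕ) (hn : 1 ≤ n)
    (K : Type) [Field K] [Algebra k K]
    (hKfg : ∃ s : Finset K, IntermediateField.adjoin k (s : Set K) = ⊤)
    (A : Type) [Ring A] [Algebra K A] [Algebra k A] [IsScalarTower k K A]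
    (hsimple : IsSimpleRing A)
    (hcenter : (algebraMap K A).range = Subring.center A)
    (hdeg : Module.finrank K A = n ^ 2) :
    (∃ (m : ℕ), 2 ≤ m ∧ ∃ X : Set (MTuple k n m),
      IsNVariety k X ∧ IsIrredSubset k X ∧
      ∃ f : ↥(coordRing k X) →ₐ[k] A, IsTotalFracHom k f) ∧
    (∀ (m m' : ℕ), 2 ≤ m → 2 ≤ m' →
      ∀ (X : Set (MTuple k n m)) (X' : Set (MTuple k n m')),
        IsNVariety k X → IsIrredSubset k X → IsNVariety k X' → IsIrredSubset k X' →
        (∃ f : ↥(coordRing k X) →ₐ[k] A, IsTotalFracHom k f) →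
        (∃ f' : ↥(coordRing k X') →ₐ[k] A, IsTotalFracHom k f') →
        NBirational k X X') := by
  refine ⟨existence k n hn K hKfg A hsimple hcenter hdeg, ?_⟩
  intro m m' _ _ X X' hX hXi hX' hXi' hf hf'
  obtain ⟨f, hf⟩ := hf
  obtain ⟨f', hf'⟩ := hf'
  have : Nontrivial A := inferInstance
  exact uniqueness k hn hX hXi hX' hXi' hdeg (model_of_frac k hn hX.1 f hf)
    (model_of_frac k hn hX'.1 f' hf')

end
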